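/- Let n >= 2, let q be a prime power, and let -1 <= i <= n-4. Let pi be an n-dimensional projective subspace of PG(2n+1,q^2) such that pi_i := pi intersect pi^sigma has projective dimension i. Let P be a point of H(2n+1,q^2) lying neither on pi nor on pi^sigma, lying on the projective span of pi and pi^sigma, and lying on some projective line all of whose points lie on H(2n+1,q^2) that contains both a point on pi but not on pi_i and a point on pi^sigma but not on pi_i. Then the number of generators mu of H(2n+1,q^2) through P such that exactly one point of mu lies on pi but not on pi_i, and exactly one point of mu lies on pi^sigma but not on pi_i, equals N(n-1,i+1) * q^{4i+4} * mu_{n-i-3}(q^2) * (q^4 * mu_{n-i-3}(q^2) + q^2 - 1). -/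

import Mathlib

open scoped BigOperators

namespace HermCode

/-- The Hermitian sesquilinear form `h(x,y) = ∑ᵢ xᵢ * yᵢ^q` on `F^m`. -/
def herm (q : ℕ) {F : Type} [Field F] {m : ℕ} (x y : Fin m → F) : F :=
  ∑ i, x i * (y i) ^ q

/-- For a fixed vector `x`, the linear map `y ↦ h(y,x)`. -/
def hermL (q : ℕ) {F : Type} [Field F] {m : ℕ} (x : Fin m → F) :
    (Fin m → F) →ₗ[F] F where
  toFun y := herm q y x
  map_add' a b := by
    simp [herm, add_mul, Finset.sum_add_distrib]
  map_smul' c a := by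
    simp [herm, Finset.mul_sum, mul_assoc]

/-- The image `W^σ` of a subspace `W` under the Hermitian polarity `σ`:
the subspace of all vectors orthogonal to every vector of `W`
with respect to the Hermitian form. -/
def polar (q : ℕ) {F : Type} [Field F] {m : ℕ} (W : Submodule F (Fin m → F)) :
    Submodule F (Fin m → F) :=
  ⨅ x : W, LinearMap.ker (hermL q (x : Fin m → F))

/-- A subspace all of whose points lie on the Hermitian variety. -/
def TotallyIsotropic (q : ℕ) {F : Type} [Field F] {m : ℕ}
    (W : Submodule F (Fin m → F)) : Prop :=
  ∀ x ∈ W, herm q x x = 0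

/-- A point of the Hermitian variety: a projective point (1-dimensional subspace)
spanned by an isotropic vector. -/
def IsHermPoint (q : ℕ) {F : Type} [Field F] {m : ℕ}
    (P : Submodule F (Fin m → F)) : Prop :=
  Module.finrank F P = 1 ∧ TotallyIsotropic q P

/-- A generator of `H(2n+1,q²)`: an `n`-dimensional projective subspace all of
whose points lie on the Hermitian variety. -/
def IsGenerator (q n : ℕ) {F : Type} [Field F]
    (W : Submodule F (Fin (2*n+2) → F)) : Prop :=
  Module.finrank F W = n + 1 ∧ TotallyIsotropic q W

/-- A code word of the dual code `C_n(H(2n+1,q²))^⊥`: a function from points to `F_p`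
(vanishing off the Hermitian variety) summing to zero over every generator. -/
def IsCodeword (p q n : ℕ) {F : Type} [Field F]
    (c : Submodule F (Fin (2*n+2) → F) → ZMod p) : Prop :=
  (∀ P, ¬ IsHermPoint q P → c P = 0) ∧
  ∀ μ, IsGenerator q n μ → (∑ᶠ P ∈ {P | IsHermPoint q P ∧ P ≤ μ}, c P) = 0

/-- The (Hamming) weight of a code word. -/
noncomputable def wt {p : ℕ} {α : Type*} (c : α → ZMod p) : ℕ :=
  Nat.card {x : α // c x ≠ 0}

open scoped Classical in
/-- The incidence vector `v_π` of `π ∩ H`. -/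
noncomputable def vsub (p q : ℕ) {F : Type} [Field F] {m : ℕ}
    (π : Submodule F (Fin m → F)) : Submodule F (Fin m → F) → ZMod p :=
  fun P => if IsHermPoint q P ∧ P ≤ π then 1 else 0

/-- `θ_m(q)`, the number of points of `PG(m,q)`. -/
noncomputable def theta (q : ℕ) (m : ℤ) : ℚ :=
  ((q:ℚ)^(m+1) - 1) / ((q:ℚ) - 1)

/-- `μ_m(q²)`, the number of points of `H(m,q²)` (with `μ_{-1} = 0`). -/
noncomputable def muH (q : ℕ) (m : ℤ) : ℚ :=
  (((q:ℚ)^(m+1) - (-1:ℚ)^(m+1)) * ((q:ℚ)^m - (-1:ℚ)^m)) / ((q:ℚ)^2 - 1)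

/-- The number `N(n,i)`. -/
noncomputable def NN (q n : ℕ) (i : ℤ) : ℚ :=
  (q:ℚ)^(((n:ℤ)-1)^2 - ((((n:ℤ)-i-1).toNat.choose 2 : ℕ) : ℤ)) *
    ∏ j ∈ Finset.range ((n:ℤ)-i-2).toNat, ((q:ℚ)^(j+1) - (-1:ℚ)^(j+1))

open scoped Classical in
/-- The quantity `Σ_{n,i}`. -/
noncomputable def SigmaNI (q n : ℕ) (i : ℤ) : ℚ :=
  if Odd ((n:ℤ) - i) then
    2*(q:ℚ)^(2*i+2) * muH q ((n:ℤ)-i-1)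
      + 4 * muH q ((n:ℤ)-i-2) * ((q:ℚ)^((n:ℤ)-i-1) - 1)
          / ((q:ℚ)^((n:ℤ)-3*i-5) * ((q:ℚ)^2 - 1))
  else
    2*(q:ℚ)^(2*i+2) * (muH q ((n:ℤ)-i-1)
      + 2*((q:ℚ)^(4:ℤ) * muH q ((n:ℤ)-i-3) + (q:ℚ)^2 - 1)/((q:ℚ)^2 - 1))

/-- `P` lies on a projective line entirely contained in the Hermitian variety that
meets both `π \ (π ⊓ π^σ)` and `π^σ \ (π ⊓ π^σ)`. -/
def OnGoodLine (q : ℕ) {F : Type} [Field F] {m : ℕ}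
    (π P : Submodule F (Fin m → F)) : Prop :=
  ∃ A B : Submodule F (Fin m → F),
    Module.finrank F A = 1 ∧ A ≤ π ∧ ¬ A ≤ π ⊓ polar q π ∧
    Module.finrank F B = 1 ∧ B ≤ polar q π ∧ ¬ B ≤ π ⊓ polar q π ∧
    P ≤ A ⊔ B ∧ TotallyIsotropic q (A ⊔ B)

set_option linter.unusedSectionVars false

/-- Basic facts on the field of order `q ^ 2` that are used throughout. -/
structure Good (q : ℕ) (F : Type) [Field F] [Fintype F] : Prop where
  two_le : 2 ≤ q
  card : Fintype.card F = q ^ 2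
  add : ∀ x y : F, (x + y) ^ q = x ^ q + y ^ q

section basics

variable {q : ℕ} {F : Type} [Field F] [Fintype F] {N : ℕ}

theorem Good.mk' {p hh : ℕ} (hp : p.Prime) (hh1 : 1 ≤ hh) (hq : q = p ^ hh)
    (hF : Fintype.card F = q ^ 2) : Good q F := by
  have : Fact p.Prime := ⟨hp⟩
  have hc : CharP F p := by
    apply charP_of_card_eq_prime_pow (f := hh * 2)
    rw [hF, hq, pow_mul]
  refine ⟨?_, hF, ?_⟩
  · rw [hq]
    calc 2 ≤ p := hp.two_le
      _ = p ^ 1 := (pow_one p).symm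
      _ ≤ p ^ hh := Nat.pow_le_pow_right hp.pos hh1
  · intro x y
    rw [hq]
    exact add_pow_char_pow x y p hh

theorem Good.inv (H : Good q F) (x : F) : (x ^ q) ^ q = x := by
  rw [← pow_mul, ← sq, ← H.card, FiniteField.pow_card]

theorem Good.q_ne (H : Good q F) : q ≠ 0 := by have := H.two_le; omega

theorem Good.neg (H : Good q F) (x : F) : (-x) ^ q = -(x ^ q) := by
  have := H.add x (-x)
  rw [add_neg_cancel, zero_pow H.q_ne] at this
  exact (neg_eq_of_add_eq_zero_right this.symm).symm

theorem Good.sum (H : Good q F) {ι : Type*} (s : Finset ι) (f : ι → F) :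
    (∑ i ∈ s, f i) ^ q = ∑ i ∈ s, f i ^ q := by
  classical
  induction s using Finset.induction_on with
  | empty => simp [H.q_ne]
  | insert a s ha ih => rw [Finset.sum_insert ha, Finset.sum_insert ha, H.add, ih]

theorem herm_add_left (x y z : Fin N → F) : herm q (x + y) z = herm q x z + herm q y z := by
  simp [herm, add_mul, Finset.sum_add_distrib]

theorem herm_smul_left (c : F) (x z : Fin N → F) : herm q (c • x) z = c * herm q x z := by
  simp [herm, Finset.mul_sum, mul_assoc]

theorem herm_zero_left (z : Fin N → F) : herm q 0 z = 0 := by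
  simp [herm]

theorem herm_symm (H : Good q F) (x y : Fin N → F) : herm q y x = herm q x y ^ q := by
  unfold herm
  rw [H.sum]
  refine Finset.sum_congr rfl fun i _ => ?_
  rw [mul_pow, H.inv, mul_comm]

theorem herm_zero_right (H : Good q F) (z : Fin N → F) : herm q z 0 = 0 := by
  rw [herm_symm H, herm_zero_left, zero_pow H.q_ne]

theorem herm_add_right (H : Good q F) (x y z : Fin N → F) :
    herm q z (x + y) = herm q z x + herm q z y := by
  rw [herm_symm H, herm_add_left, H.add, ← herm_symm H, ← herm_symm H]

theorem herm_smul_right (H : Good q F) (c : F) (x z : Fin N → F) :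
    herm q z (c • x) = c ^ q * herm q z x := by
  rw [herm_symm H, herm_smul_left, mul_pow, ← herm_symm H]

theorem herm_eq_zero_symm (H : Good q F) {x y : Fin N → F} (h : herm q x y = 0) :
    herm q y x = 0 := by
  rw [herm_symm H, h, zero_pow H.q_ne]

theorem mem_polar {W : Submodule F (Fin N → F)} {y : Fin N → F} :
    y ∈ polar q W ↔ ∀ x ∈ W, herm q y x = 0 := by
  simp only [polar, Submodule.mem_iInf, LinearMap.mem_ker, Subtype.forall]
  exact Iff.rfl

theorem mem_polar' (H : Good q F) {W : Submodule F (Fin N → F)} {y : Fin N → F} :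
    y ∈ polar q W ↔ ∀ x ∈ W, herm q x y = 0 := by
  rw [mem_polar]
  exact ⟨fun h x hx => herm_eq_zero_symm H (h x hx), fun h x hx => herm_eq_zero_symm H (h x hx)⟩

theorem mem_polar_span (H : Good q F) {x y : Fin N → F} :
    y ∈ polar q (F ∙ x) ↔ herm q y x = 0 := by
  rw [mem_polar]
  constructor
  · intro h; exact h x (Submodule.mem_span_singleton_self x)
  · intro h z hz
    obtain ⟨c, rfl⟩ := Submodule.mem_span_singleton.1 hz
    rw [herm_smul_right H, h, mul_zero]

theorem le_polar_comm (H : Good q F) {U W : Submodule F (Fin N → F)} :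
    U ≤ polar q W ↔ W ≤ polar q U := by
  constructor
  · intro h x hx
    exact mem_polar.2 fun y hy => herm_eq_zero_symm H (mem_polar.1 (h hy) x hx)
  · intro h x hx
    exact mem_polar.2 fun y hy => herm_eq_zero_symm H (mem_polar.1 (h hy) x hx)

theorem polar_anti {U W : Submodule F (Fin N → F)} (h : U ≤ W) : polar q W ≤ polar q U :=
  fun _ hx => mem_polar.2 fun y hy => mem_polar.1 hx y (h hy)

theorem polar_sup (H : Good q F) (U W : Submodule F (Fin N → F)) :
    polar q (U ⊔ W) = polar q U ⊓ polar q W := by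
  apply le_antisymm
  · exact le_inf (polar_anti le_sup_left) (polar_anti le_sup_right)
  · rw [le_polar_comm H]
    exact sup_le ((le_polar_comm H).1 inf_le_left) ((le_polar_comm H).1 inf_le_right)

theorem polar_top (H : Good q F) : polar q (⊤ : Submodule F (Fin N → F)) = ⊥ := by
  rw [eq_bot_iff]
  intro x hx
  rw [mem_polar] at hx
  rw [Submodule.mem_bot]
  ext i
  have := hx (Pi.single i 1) trivial
  unfold herm at this
  rw [Finset.sum_eq_single i] at this
  · simpa using this
  · intro j _ hj
    simp [Pi.single_eq_of_ne hj, H.q_ne]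
  · simp

theorem polar_bot (H : Good q F) : polar q (⊥ : Submodule F (Fin N → F)) = ⊤ := by
  rw [eq_top_iff, le_polar_comm H]; exact bot_le

/-- Cutting a subspace by a hyperplane. -/
theorem finrank_inf_perp (H : Good q F) {W : Submodule F (Fin N → F)} {v : Fin N → F}
    (h : v ∉ polar q W) :
    Module.finrank F ↥(W ⊓ polar q (F ∙ v)) + 1 = Module.finrank F W := by
  let f : W →ₗ[F] F := (hermL q v).comp W.subtype
  have hker : Submodule.map W.subtype (LinearMap.ker f) = W ⊓ polar q (F ∙ v) := by
    ext x
    simp only [Submodule.mem_map, LinearMap.mem_ker, Submodule.mem_inf, mem_polar_span H]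
    constructor
    · rintro ⟨y, hy, rfl⟩; exact ⟨y.2, hy⟩
    · rintro ⟨h1, h2⟩; exact ⟨⟨x, h1⟩, h2, rfl⟩
  have hf : f ≠ 0 := by
    intro h0
    apply h
    rw [mem_polar' H]
    intro x hx
    exact LinearMap.congr_fun h0 ⟨x, hx⟩
  have h1 := LinearMap.finrank_range_add_finrank_ker f
  have h2 : LinearMap.range f = ⊤ := LinearMap.range_eq_top.2 (LinearMap.surjective hf)
  rw [h2, finrank_top, Module.finrank_self] at h1
  rw [← hker, Submodule.finrank_map_subtype_eq]
  omega

theorem finrank_sup_span {W : Submodule F (Fin N → F)} {v : Fin N → F} (h : v ∉ W) :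
    Module.finrank F ↥(W ⊔ F ∙ v) = Module.finrank F W + 1 := by
  have hv : v ≠ 0 := fun h0 => h (h0 ▸ W.zero_mem)
  have h1 := Submodule.finrank_sup_add_finrank_inf_eq W (F ∙ v)
  have h2 : W ⊓ F ∙ v = ⊥ := by
    rw [← disjoint_iff]
    exact (Submodule.disjoint_span_singleton' hv).2 h
  rw [h2, finrank_bot, finrank_span_singleton hv] at h1
  omega

theorem finrank_polar_aux (H : Good q F) : ∀ (d : ℕ) (U W : Submodule F (Fin N → F)), U ≤ W →
    Module.finrank F W = Module.finrank F U + d →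
    Module.finrank F ↥(polar q U) ≤ Module.finrank F ↥(polar q W) + d := by
  intro d
  induction d with
  | zero =>
    intro U W h hd
    rw [Submodule.eq_of_le_of_finrank_eq h (by omega)]; omega
  | succ d ih =>
    intro U W h hd
    obtain ⟨v, hv, hvU⟩ : ∃ v ∈ W, v ∉ U := by
      by_contra! hc
      have := Submodule.finrank_mono (show W ≤ U from hc)
      omega
    have h1 := finrank_sup_span hvU
    have h2 := ih (U ⊔ F ∙ v) W (sup_le h ((Submodule.span_singleton_le_iff_mem _ _).2 hv))
      (by omega)
    rw [polar_sup H] at h2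
    by_cases h3 : v ∈ polar q (polar q U)
    · have h4 : polar q U ≤ polar q (F ∙ v) := by
        rw [le_polar_comm H]; exact (Submodule.span_singleton_le_iff_mem _ _).2 h3
      rw [inf_eq_left.2 h4] at h2
      omega
    · have := finrank_inf_perp H h3
      omega

theorem finrank_polar (H : Good q F) (W : Submodule F (Fin N → F)) :
    Module.finrank F ↥(polar q W) + Module.finrank F W = N := by
  have hN : Module.finrank F (Fin N → F) = N := by simp
  have hle := Submodule.finrank_le W
  have h1 := finrank_polar_aux H (Module.finrank F W) ⊥ W bot_le (by simp)
  have h2 := finrank_polar_aux H (N - Module.finrank F W) W ⊤ le_top (by rw [finrank_top]; omega)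
  rw [polar_bot H, finrank_top] at h1
  rw [polar_top H, finrank_bot] at h2
  omega

theorem polar_polar (H : Good q F) (W : Submodule F (Fin N → F)) : polar q (polar q W) = W := by
  symm
  apply Submodule.eq_of_le_of_finrank_eq ((le_polar_comm H).1 le_rfl)
  have h1 := finrank_polar H W
  have h2 := finrank_polar H (polar q W)
  omega

theorem polar_inf (H : Good q F) (U W : Submodule F (Fin N → F)) :
    polar q (U ⊓ W) = polar q U ⊔ polar q W := by
  conv_lhs => rw [← polar_polar H U, ← polar_polar H W, ← polar_sup H, polar_polar H]

end basics

section fieldcount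

theorem fiber_exact {α β : Type*} [Fintype α] [DecidableEq β] (f : α → β) (B : Finset β)
    (a b : ℕ) (hmap : ∀ x, f x ∈ B) (hfib : ∀ y ∈ B, (Finset.univ.filter fun x => f x = y).card ≤ a)
    (hB : B.card ≤ b) (hα : Fintype.card α = a * b) :
    ∀ y ∈ B, (Finset.univ.filter fun x => f x = y).card = a := by
  intro y hy
  by_contra hne
  have hlt := lt_of_le_of_ne (hfib y hy) hne
  have h1 := Finset.card_eq_sum_card_fiberwise (f := f) (s := Finset.univ) (t := B)
    (fun x _ => hmap x)
  have h2 : ∑ z ∈ B, (Finset.univ.filter fun x => f x = z).card < ∑ z ∈ B, a :=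
    Finset.sum_lt_sum hfib ⟨y, hy, hlt⟩
  rw [← h1, Finset.sum_const, smul_eq_mul, Finset.card_univ, hα] at h2
  nlinarith

variable {q : ℕ} {F : Type} [Field F] [Fintype F]

theorem norm_count (H : Good q F) {c : F} (hc : c ^ q = c) (h0 : c ≠ 0) :
    Nat.card {t : F // t ^ (q + 1) = c} = q + 1 := by
  classical
  have hq := H.two_le
  have hroot : ∀ (k : ℕ) (d : F), 0 < k → (Finset.univ.filter fun x : F => x ^ k = d).card ≤ k := by
    intro k d hk
    refine le_trans ?_ (Polynomial.card_nthRoots k d)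
    have : (Finset.univ.filter fun x : F => x ^ k = d) ⊆ (Polynomial.nthRoots k d).toFinset := by
      intro x hx
      simp only [Finset.mem_filter, Finset.mem_univ, true_and] at hx
      simp [Polynomial.mem_nthRoots hk, hx]
    exact (Finset.card_le_card this).trans (Multiset.toFinset_card_le _)
  have key := fiber_exact (α := Fˣ) (fun t => (t : F) ^ (q + 1))
    (Finset.univ.filter fun x : F => x ^ (q - 1) = 1) (q + 1) (q - 1) ?_ ?_ (hroot _ _ (by omega)) ?_ c ?_
  · refine Eq.trans ?_ key
    rw [Nat.card_eq_fintype_card, Fintype.card_subtype]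
    symm
    refine Finset.card_bij (fun t _ => (t : F)) ?_ ?_ ?_
    · intro a ha; simpa using ha
    · intro a _ b _ hab; exact Units.ext hab
    · intro b hb
      have hb' : b ^ (q + 1) = c := by simpa using hb
      have hb0 : b ≠ 0 := by
        rintro rfl
        apply h0
        rw [← hb', zero_pow (by omega)]
      exact ⟨Units.mk0 b hb0, by simpa using hb', rfl⟩
  · intro t
    simp only [Finset.mem_filter, Finset.mem_univ, true_and]
    rw [← pow_mul]
    have : (q + 1) * (q - 1) = Fintype.card F - 1 := by
      rw [H.card]
      obtain ⟨k, rfl⟩ : ∃ k, q = k + 1 := ⟨q - 1, by omega⟩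
      simp only [Nat.add_sub_cancel]
      have : (k + 1) ^ 2 = (k + 1 + 1) * k + 1 := by ring
      omega
    rw [this]
    exact FiniteField.pow_card_sub_one_eq_one _ t.ne_zero
  · intro y _
    refine le_trans ?_ (hroot (q + 1) y (by omega))
    refine Finset.card_le_card_of_injOn (fun t => (t : F)) ?_ ?_
    · intro a ha; simpa using ha
    · intro a _ b _ hab; exact Units.ext hab
  · rw [Fintype.card_units, H.card]
    obtain ⟨k, rfl⟩ : ∃ k, q = k + 1 := ⟨q - 1, by omega⟩
    simp only [Nat.add_sub_cancel]
    have : (k + 1) ^ 2 = (k + 1 + 1) * k + 1 := by ring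
    omega
  · simp only [Finset.mem_filter, Finset.mem_univ, true_and]
    have : c ^ (q - 1) * c = 1 * c := by
      rw [← pow_succ, Nat.sub_add_cancel (by omega), hc, one_mul]
    exact mul_right_cancel₀ h0 this

theorem trace_count (H : Good q F) {c : F} (hc : c ^ q = c) :
    Nat.card {t : F // t + t ^ q = c} = q := by
  classical
  have hq := H.two_le
  have hroot : ∀ (k : F) (d : F), (Finset.univ.filter fun x : F => x ^ q + k * x = d).card ≤ q := by
    intro k d
    let P : Polynomial F := Polynomial.X ^ q + (Polynomial.C k * Polynomial.X - Polynomial.C d)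
    have hlow : (Polynomial.C k * Polynomial.X - Polynomial.C d).degree < (q : WithBot ℕ) := by
      refine lt_of_le_of_lt (b := (1 : WithBot ℕ)) (by compute_degree) (by exact_mod_cast hq)
    have hdeg : P.degree = q := by
      show (Polynomial.X ^ q + _ : Polynomial F).degree = q
      rw [Polynomial.degree_add_eq_left_of_degree_lt (by rwa [Polynomial.degree_X_pow]),
        Polynomial.degree_X_pow]
    have hP0 : P ≠ 0 := by
      intro h
      rw [h] at hdeg
      simp at hdeg
    have hn : P.natDegree = q := Polynomial.natDegree_eq_of_degree_eq_some hdeg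
    have : (Finset.univ.filter fun x : F => x ^ q + k * x = d) ⊆ P.roots.toFinset := by
      intro x hx
      simp only [Finset.mem_filter, Finset.mem_univ, true_and] at hx
      rw [Multiset.mem_toFinset, Polynomial.mem_roots hP0]
      simp [P, Polynomial.IsRoot, ← hx]
    calc _ ≤ _ := Finset.card_le_card this
      _ ≤ _ := Multiset.toFinset_card_le _
      _ ≤ _ := Polynomial.card_roots' P
      _ = q := hn
  have key := fiber_exact (α := F) (fun t => t ^ q + 1 * t)
    (Finset.univ.filter fun x : F => x ^ q + (-1) * x = 0) q q ?_ ?_ (hroot _ _) ?_ c ?_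
  · rw [Nat.card_eq_fintype_card, Fintype.card_subtype]
    conv_rhs => rw [← key]
    congr 1
    ext x
    simp [add_comm]
  · intro t
    simp only [Finset.mem_filter, Finset.mem_univ, true_and]
    rw [one_mul, H.add, H.inv]; ring
  · intro y _
    exact hroot 1 y
  · rw [H.card]; ring
  · simp [hc]

theorem eq_zero_of_trace (H : Good q F) {c : F} (h : ∀ l : F, l * c + (l * c) ^ q = 0) : c = 0 := by
  by_contra hc
  have h1 := trace_count H (c := (0 : F)) (zero_pow H.q_ne)
  have h2 : ∀ t : F, t + t ^ q = 0 := by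
    intro t
    have := h (t / c)
    rwa [div_mul_cancel₀ _ hc] at this
  have h3 : Nat.card {t : F // t + t ^ q = 0} = Nat.card F :=
    Nat.card_congr (Equiv.subtypeUnivEquiv h2)
  rw [h1, Nat.card_eq_fintype_card, H.card] at h3
  have := H.two_le
  nlinarith

end fieldcount

section radicals

variable {q : ℕ} {F : Type} [Field F] [Fintype F] {N : ℕ}

theorem TI_le_polar (H : Good q F) {W : Submodule F (Fin N → F)} (h : TotallyIsotropic q W) :
    W ≤ polar q W := by
  intro x hx
  rw [mem_polar]
  intro y hy
  apply eq_zero_of_trace H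
  intro l
  have h1 := h (l • x + y) (W.add_mem (W.smul_mem _ hx) hy)
  rw [herm_add_left, herm_add_right H, herm_add_right H, h y hy, h _ (W.smul_mem l hx),
    herm_symm H (l • x) y, herm_smul_left] at h1
  simpa using h1

theorem TI_of_le_polar {W : Submodule F (Fin N → F)} (h : W ≤ polar q W) :
    TotallyIsotropic q W := fun x hx => mem_polar.1 (h hx) x hx

theorem rad_sup (H : Good q F) {X T : Submodule F (Fin N → F)} (h : T ≤ polar q (X ⊔ T)) :
    (X ⊔ T) ⊓ polar q (X ⊔ T) = (X ⊓ polar q X) ⊔ T := by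
  have hX : X ≤ polar q T := le_sup_left.trans ((le_polar_comm H).1 h)
  have hT : T ≤ polar q T := h.trans (polar_anti le_sup_right)
  have hT2 : T ≤ polar q X := h.trans (polar_anti le_sup_left)
  rw [polar_sup H]
  apply le_antisymm
  · rintro x ⟨hx1, hx2, _⟩
    obtain ⟨y, hy, t, ht, rfl⟩ := Submodule.mem_sup.1 hx1
    refine Submodule.add_mem_sup ⟨hy, ?_⟩ ht
    have := (polar q X).sub_mem hx2 (hT2 ht)
    simpa using this
  · refine sup_le ?_ ?_
    · exact le_inf (inf_le_left.trans le_sup_left) (le_inf inf_le_right (inf_le_left.trans hX))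
    · exact le_inf le_sup_right (le_inf hT2 hT)

theorem rad_cut_aniso (H : Good q F) {W : Submodule F (Fin N → F)} {w : Fin N → F} (hw : w ∈ W)
    (h : herm q w w ≠ 0) :
    (W ⊓ polar q (F ∙ w)) ⊓ polar q (W ⊓ polar q (F ∙ w)) = W ⊓ polar q W := by
  rw [polar_inf H, polar_polar H]
  apply le_antisymm
  · rintro x ⟨⟨hx1, hx2⟩, hx3⟩
    obtain ⟨y, hy, z, hz, rfl⟩ := Submodule.mem_sup.1 hx3
    obtain ⟨c, rfl⟩ := Submodule.mem_span_singleton.1 hz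
    have h1 := (mem_polar_span H).1 hx2
    rw [herm_add_left, herm_smul_left, mem_polar.1 hy w hw, zero_add] at h1
    have hc : c = 0 := (mul_eq_zero.1 h1).resolve_right h
    subst hc
    simp only [zero_smul, add_zero] at hx1 ⊢
    exact ⟨hx1, hy⟩
  · have : polar q W ≤ polar q (F ∙ w) :=
      polar_anti ((Submodule.span_singleton_le_iff_mem _ _).2 hw)
    exact le_inf (le_inf inf_le_left (inf_le_right.trans this)) (inf_le_right.trans le_sup_left)

theorem rad_cut_iso (H : Good q F) {W : Submodule F (Fin N → F)} {a : Fin N → F} (ha : a ∈ W)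
    (h : herm q a a = 0) :
    (W ⊓ polar q (F ∙ a)) ⊓ polar q (W ⊓ polar q (F ∙ a)) = W ⊓ polar q W ⊔ F ∙ a := by
  rw [polar_inf H, polar_polar H]
  have haW : F ∙ a ≤ W := (Submodule.span_singleton_le_iff_mem _ _).2 ha
  have haa : F ∙ a ≤ polar q (F ∙ a) :=
    (Submodule.span_singleton_le_iff_mem _ _).2 ((mem_polar_span H).2 h)
  have : polar q W ≤ polar q (F ∙ a) := polar_anti haW
  apply le_antisymm
  · rintro x ⟨⟨hx1, hx2⟩, hx3⟩
    obtain ⟨y, hy, z, hz, rfl⟩ := Submodule.mem_sup.1 hx3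
    refine Submodule.add_mem_sup ⟨?_, hy⟩ hz
    have := W.sub_mem hx1 (haW hz)
    simpa using this
  · refine sup_le (le_inf (le_inf inf_le_left (inf_le_right.trans this))
      (inf_le_right.trans le_sup_left)) (le_inf (le_inf haW haa) le_sup_right)

theorem card_sub (H : Good q F) (W : Submodule F (Fin N → F)) :
    Nat.card W = q ^ (2 * Module.finrank F W) := by
  rw [Module.natCard_eq_pow_finrank (K := F), Nat.card_eq_fintype_card, H.card, pow_mul]

/-- Number of vectors of a given nonzero norm in a nondegenerate space of dimension `m`. -/
noncomputable def N1 (q m : ℕ) : ℚ := (q : ℚ) ^ m * ((q : ℚ) ^ m - (-1) ^ m) / q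

/-- Number of isotropic vectors in a nondegenerate space of dimension `m`. -/
noncomputable def N0 (q m : ℕ) : ℚ :=
  ((q : ℚ) ^ (2 * m) + (-1) ^ m * ((q : ℚ) - 1) * (q : ℚ) ^ m) / q

theorem herm_self_fixed (H : Good q F) (x : Fin N → F) : herm q x x ^ q = herm q x x :=
  (herm_symm H x x).symm

/-- Splitting off an anisotropic vector. -/
noncomputable def splitEquiv (H : Good q F) (W : Submodule F (Fin N → F)) (w : Fin N → F)
    (hw : w ∈ W) (h : herm q w w ≠ 0) (c : F) :
    {x : Fin N → F // x ∈ W ∧ herm q x x = c} ≃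
      Σ t : F, {y : Fin N → F // y ∈ W ⊓ polar q (F ∙ w) ∧
        herm q y y = c - t ^ (q + 1) * herm q w w} where
  toFun x := ⟨herm q x.1 w / herm q w w, x.1 - (herm q x.1 w / herm q w w) • w, by
    obtain ⟨x, hx, hc⟩ := x
    have hperp : herm q (x - (herm q x w / herm q w w) • w) w = 0 := by
      rw [sub_eq_add_neg, ← neg_smul, herm_add_left, herm_smul_left, neg_mul,
        div_mul_cancel₀ _ h, add_neg_cancel]
    refine ⟨⟨W.sub_mem hx (W.smul_mem _ hw), (mem_polar_span H).2 hperp⟩, ?_⟩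
    set t := herm q x w / herm q w w
    obtain ⟨y, hy⟩ : ∃ y, y = x - t • w := ⟨_, rfl⟩
    have hxy : x = y + t • w := by rw [hy]; simp
    simp only
    rw [← hy] at hperp ⊢
    rw [← hc, hxy, herm_add_left, herm_add_right H, herm_add_right H, herm_smul_left,
      herm_smul_left, herm_smul_right H, herm_smul_right H, hperp,
      herm_eq_zero_symm H hperp]
    ring⟩
  invFun z := ⟨z.2.1 + z.1 • w, by
    obtain ⟨t, y, ⟨hy1, hy2⟩, hy3⟩ := z
    have hperp := (mem_polar_span H).1 hy2
    refine ⟨W.add_mem hy1 (W.smul_mem _ hw), ?_⟩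
    simp only
    rw [herm_add_left, herm_add_right H, herm_add_right H, herm_smul_left,
      herm_smul_left, herm_smul_right H, herm_smul_right H, hperp,
      herm_eq_zero_symm H hperp, hy3]
    ring⟩
  left_inv x := by simp
  right_inv z := by
    obtain ⟨t, y, ⟨hy1, hy2⟩, hy3⟩ := z
    have hperp := (mem_polar_span H).1 hy2
    have ht : herm q (y + t • w) w / herm q w w = t := by
      rw [herm_add_left, herm_smul_left, hperp, zero_add, mul_div_cancel_right₀ _ h]
    simp only
    apply Sigma.subtype_ext
    · exact ht
    · simp [ht]

open scoped Classical in
theorem norm_vec_count (H : Good q F) : ∀ (m s : ℕ) (W : Submodule F (Fin N → F)),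
    Module.finrank F W = s + m → Module.finrank F ↥(W ⊓ polar q W) = s → ∀ c : F, c ^ q = c →
    (Nat.card {x : Fin N → F // x ∈ W ∧ herm q x x = c} : ℚ) =
      (q : ℚ) ^ (2 * s) * (if c = 0 then N0 q m else N1 q m) := by
  have hq0 : (q : ℚ) ≠ 0 := by exact_mod_cast H.q_ne
  intro m
  induction m with
  | zero =>
    intro s W hW hR c hc
    have hWR : W ≤ polar q W := by
      rw [← inf_eq_left]
      exact Submodule.eq_of_le_of_finrank_eq inf_le_left (by omega)
    have hTI := TI_of_le_polar hWR
    split_ifs with h0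
    · subst h0
      have : Nat.card {x : Fin N → F // x ∈ W ∧ herm q x x = 0} = Nat.card W :=
        Nat.card_congr (Equiv.subtypeEquivRight fun x => ⟨fun h => h.1, fun h => ⟨h, hTI x h⟩⟩)
      rw [this, card_sub H, hW]
      simp [N0, hq0]
    · have : IsEmpty {x : Fin N → F // x ∈ W ∧ herm q x x = c} :=
        ⟨fun x => h0 (by rw [← x.2.2, hTI _ x.2.1])⟩
      simp [N1]
  | succ m ih =>
    intro s W hW hR c hc
    obtain ⟨w, hw, hww⟩ : ∃ w ∈ W, herm q w w ≠ 0 := by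
      by_contra! hcon
      rw [inf_eq_left.2 (TI_le_polar H hcon)] at hR
      omega
    have hwp : w ∉ polar q W := fun h => hww (mem_polar.1 h w hw)
    have hd := finrank_inf_perp H hwp
    have hW0 := ih s (W ⊓ polar q (F ∙ w)) (by omega) (by rw [rad_cut_aniso H hw hww, hR])
    rw [Nat.card_congr (splitEquiv H W w hw hww c), Nat.card_sigma]
    push_cast
    have hfix := herm_self_fixed H w
    have hterm : ∀ t : F, (Nat.card {y : Fin N → F // y ∈ W ⊓ polar q (F ∙ w) ∧
        herm q y y = c - t ^ (q + 1) * herm q w w} : ℚ) =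
        if t ^ (q + 1) = c / herm q w w then (q : ℚ) ^ (2 * s) * N0 q m
          else (q : ℚ) ^ (2 * s) * N1 q m := by
      intro t
      rw [hW0 (c - t ^ (q + 1) * herm q w w)]
      · have : (c - t ^ (q + 1) * herm q w w = 0) ↔ t ^ (q + 1) = c / herm q w w := by
          rw [eq_div_iff hww, sub_eq_zero, eq_comm]
        simp only [this]
        split_ifs <;> rfl
      · have h1 : (t ^ (q + 1)) ^ q = t ^ (q + 1) := by
          rw [pow_succ, mul_pow, H.inv, mul_comm]
        rw [sub_eq_add_neg, H.add, H.neg, mul_pow, h1, hfix, hc]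
    simp only [hterm]
    rw [Finset.sum_ite, Finset.sum_const, Finset.sum_const]
    have hcompl := Finset.card_filter_add_card_filter_not (s := (Finset.univ : Finset F))
      (fun t : F => t ^ (q + 1) = c / herm q w w)
    rw [Finset.card_univ, H.card] at hcompl
    have hK : (Finset.univ.filter fun t : F => t ^ (q + 1) = c / herm q w w).card =
        if c = 0 then 1 else q + 1 := by
      split_ifs with h0
      · subst h0
        rw [Finset.card_eq_one]
        refine ⟨0, ?_⟩
        ext t
        simp
      · refine Eq.trans ?_ (norm_count H (c := c / herm q w w) (by rw [div_pow, hc, hfix])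
          (div_ne_zero h0 hww))
        rw [Nat.card_eq_fintype_card, Fintype.card_subtype]
    have hcompl' : ((Finset.univ.filter fun t : F => ¬ t ^ (q + 1) = c / herm q w w).card : ℚ) =
        (q : ℚ) ^ 2 - (if c = 0 then 1 else q + 1 : ℕ) := by
      rw [hK] at hcompl
      rw [eq_sub_iff_add_eq']
      exact_mod_cast hcompl
    rw [nsmul_eq_mul, nsmul_eq_mul, hcompl', hK]
    split_ifs
    · simp only [N0, N1]
      push_cast
      field_simp
      ring
    · simp only [N0, N1]
      push_cast
      field_simp
      ring

end radicals

section recursion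

theorem card_sub_sub {α : Type*} {A B C : α → Prop} (h : ∀ x, (A x ∧ B x) ↔ C x) :
    Nat.card {x : {x // A x} // B x.1} = Nat.card {x // C x} :=
  Nat.card_congr ((Equiv.subtypeSubtypeEquivSubtypeInter A B).trans
    (Equiv.subtypeEquivRight h))

theorem double_count {α β : Type*} [Finite α] [Finite β] (r : α → β → Prop) (a b : ℚ)
    (h1 : ∀ x, (Nat.card {y // r x y} : ℚ) = a) (h2 : ∀ y, (Nat.card {x // r x y} : ℚ) = b) :
    (Nat.card α : ℚ) * a = Nat.card β * b := by
  have := Fintype.ofFinite α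
  have := Fintype.ofFinite β
  have e1 : (Σ x, {y // r x y}) ≃ (Σ y, {x // r x y}) :=
    { toFun := fun z => ⟨z.2.1, z.1, z.2.2⟩
      invFun := fun z => ⟨z.2.1, z.1, z.2.2⟩
      left_inv := fun _ => rfl
      right_inv := fun _ => rfl }
  have e2 := Nat.card_congr e1
  rw [Nat.card_sigma, Nat.card_sigma] at e2
  have e3 : ((∑ x, Nat.card {y // r x y} : ℕ) : ℚ) = ((∑ y, Nat.card {x // r x y} : ℕ) : ℚ) := by
    rw [e2]
  push_cast at e3
  simp only [h1, h2, Finset.sum_const, Finset.card_univ, nsmul_eq_mul] at e3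
  rw [Nat.card_eq_fintype_card, Nat.card_eq_fintype_card]
  exact e3

variable {q : ℕ} {F : Type} [Field F] [Fintype F] {N : ℕ}

/-- Maximal totally isotropic subspaces meeting `W` exactly in `T`. -/
def GS (q M : ℕ) (W T μ : Submodule F (Fin N → F)) : Prop :=
  Module.finrank F μ = M ∧ TotallyIsotropic q μ ∧ μ ⊓ W = T

theorem card_trace (H : Good q F) {W : Submodule F (Fin N → F)} {e : Fin N → F}
    (he : e ∉ polar q W) {d : ℕ} (hd : Module.finrank F W = d + 1) {c : F} (hc : c ^ q = c) :
    (Nat.card {w : Fin N → F // w ∈ W ∧ herm q w e + herm q w e ^ q = c} : ℚ)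
      = (q : ℚ) ^ (2 * d + 1) := by
  have hk := finrank_inf_perp H he
  obtain ⟨z, hz, hze⟩ : ∃ z ∈ W, herm q z e ≠ 0 := by
    by_contra! hcon
    exact he ((mem_polar' H).2 hcon)
  have key := double_count
    (α := {w : Fin N → F // w ∈ W ∧ herm q w e + herm q w e ^ q = c})
    (β := {t : F // t + t ^ q = c}) (fun w t => herm q w.1 e = t.1) 1 ((q : ℚ) ^ (2 * d)) ?_ ?_
  · rw [mul_one, trace_count H hc] at key
    rw [key]; ring
  · rintro ⟨w, hw, hwc⟩
    have : Unique {y : {t : F // t + t ^ q = c} // herm q w e = y.1} :=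
      { default := ⟨⟨_, hwc⟩, rfl⟩
        uniq := by rintro ⟨⟨y, hy⟩, hy'⟩; simp only at hy'; subst hy'; rfl }
    simp
  · rintro ⟨t, ht⟩
    have hcard : Nat.card ↥(W ⊓ polar q (F ∙ e)) = q ^ (2 * d) := by
      rw [card_sub H]; congr 2; omega
    rw [← Nat.cast_pow, ← hcard]
    congr 1
    let w0 := (t / herm q z e) • z
    have hw0 : w0 ∈ W := W.smul_mem _ hz
    have hw0e : herm q w0 e = t := by
      simp only [w0]
      rw [herm_smul_left, div_mul_cancel₀ _ hze]
    refine Nat.card_congr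
      { toFun := fun x => ⟨x.1.1 - w0, W.sub_mem x.1.2.1 hw0, ?_⟩
        invFun := fun y => ⟨⟨y.1 + w0, W.add_mem y.2.1 hw0, ?_⟩, ?_⟩
        left_inv := fun x => by simp
        right_inv := fun y => by simp }
    · rw [SetLike.mem_coe, mem_polar_span H, sub_eq_add_neg, ← neg_one_smul F w0, herm_add_left, herm_smul_left, hw0e,
        x.2]
      ring
    · rw [herm_add_left, (mem_polar_span H).1 y.2.2, hw0e, zero_add, ht]
    · simp only
      rw [herm_add_left, (mem_polar_span H).1 y.2.2, hw0e, zero_add]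

theorem step (H : Good q F) {M : ℕ} (hN : N = 2 * M) {W T : Submodule F (Fin N → F)}
    {e : Fin N → F} (hW : Module.finrank F W = M) (hT : T ≤ W ⊓ polar q W) (he : e ∈ polar q T)
    (heW : e ∉ W) (K : ℚ)
    (hK : ∀ v, v - e ∈ W → herm q v v = 0 → (Nat.card {μ : Submodule F (Fin N → F) //
      GS q M (W ⊓ polar q (F ∙ v) ⊔ F ∙ v) (T ⊔ F ∙ v) μ} : ℚ) = K) :
    (Nat.card {μ : Submodule F (Fin N → F) // GS q M W T μ} : ℚ)
      * (q : ℚ) ^ (2 * Module.finrank F T)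
      = Nat.card {v : Fin N → F // v - e ∈ W ∧ herm q v v = 0} * K := by
  have hTp : polar q W ≤ polar q T := polar_anti (hT.trans inf_le_left)
  have hWT : W ≤ polar q T := by
    rw [le_polar_comm H]; exact hT.trans inf_le_right
  apply double_count (fun μ v => v.1 ∈ μ.1)
  · rintro ⟨μ, hμ1, hμ2, hμ3⟩
    have hTμ : T ≤ μ := hμ3 ▸ inf_le_left
    have hμT : μ ≤ polar q T := (TI_le_polar H hμ2).trans (polar_anti hTμ)
    have hsup : μ ⊔ W = polar q T := by
      apply Submodule.eq_of_le_of_finrank_eq (sup_le hμT hWT)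
      have h1 := Submodule.finrank_sup_add_finrank_inf_eq μ W
      have h2 := finrank_polar H T
      rw [hμ3] at h1
      omega
    rw [← hsup] at he
    obtain ⟨v0, hv0, w, hw, rfl⟩ := Submodule.mem_sup.1 he
    rw [← Nat.cast_pow, ← card_sub H T]
    congr 1
    have hTW : T ≤ W := hT.trans inf_le_left
    refine Nat.card_congr
      { toFun := fun x => ⟨x.1.1 - v0, ?_⟩
        invFun := fun y => ⟨⟨y.1 + v0, ?_, ?_⟩, ?_⟩
        left_inv := fun x => by simp
        right_inv := fun y => by simp }
    · refine hμ3.le ⟨μ.sub_mem x.2 hv0, ?_⟩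
      have := W.add_mem x.1.2.1 hw
      rw [SetLike.mem_coe]
      convert this using 1
      abel
    · have := W.sub_mem (hTW y.2) hw
      convert this using 1
      abel
    · exact hμ2 _ (μ.add_mem (hTμ y.2) hv0)
    · exact μ.add_mem (hTμ y.2) hv0
  · rintro ⟨v, hv, hvv⟩
    rw [← hK v hv hvv]
    congr 1
    have hvW : v ∉ W := by
      intro h
      apply heW
      have := W.sub_mem h hv
      simpa using this
    have hvT : v ∈ polar q T := by
      have := (polar q T).add_mem (hWT hv) he
      simpa using this
    refine card_sub_sub (A := GS q M W T) (B := fun μ => v ∈ μ) fun μ => ?_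
    constructor
    · rintro ⟨⟨h1, h2, h3⟩, h4⟩
      refine ⟨h1, h2, ?_⟩
      have hTμ : T ≤ μ := h3 ▸ inf_le_left
      have hTW : T ≤ W := hT.trans inf_le_left
      apply le_antisymm
      · rintro x ⟨hx1, hx2⟩
        obtain ⟨y, hy, z, hz, rfl⟩ := Submodule.mem_sup.1 hx2
        refine Submodule.add_mem_sup ?_ hz
        rw [← h3]
        refine ⟨?_, hy.1⟩
        obtain ⟨c, rfl⟩ := Submodule.mem_span_singleton.1 hz
        have := μ.sub_mem hx1 (μ.smul_mem c h4)
        simpa using this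
      · have h5 : F ∙ v ≤ μ := (Submodule.span_singleton_le_iff_mem _ _).2 h4
        refine le_inf (sup_le hTμ h5) (sup_le_sup_right (le_inf hTW ?_) _)
        rw [le_polar_comm H]
        exact (Submodule.span_singleton_le_iff_mem _ _).2 hvT
    · rintro ⟨h1, h2, h3⟩
      have h4 : T ⊔ F ∙ v ≤ μ := h3 ▸ inf_le_left
      have h5 : v ∈ μ := h4 (le_sup_right (a := T) (Submodule.mem_span_singleton_self v))
      refine ⟨⟨h1, h2, ?_⟩, h5⟩
      apply le_antisymm
      · rintro x ⟨hx1, hx2⟩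
        have hx3 : x ∈ T ⊔ F ∙ v := by
          rw [← h3]
          refine ⟨hx1, Submodule.mem_sup_left ⟨hx2, ?_⟩⟩
          exact (mem_polar_span H).2 (mem_polar.1 (TI_le_polar H h2 hx1) v h5)
        obtain ⟨t, ht, z, hz, rfl⟩ := Submodule.mem_sup.1 hx3
        obtain ⟨c, rfl⟩ := Submodule.mem_span_singleton.1 hz
        have h6 : c • v ∈ W := by
          have := W.sub_mem hx2 (hT ht).1
          simpa using this
        have hc : c = 0 := by
          by_contra hc
          exact hvW ((Submodule.smul_mem_iff _ hc).1 h6)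
        simpa [hc] using ht
      · exact le_inf (le_sup_left.trans h4) (hT.trans inf_le_left)

/-- The number of maximal totally isotropic subspaces meeting `W` exactly in `T`. -/
noncomputable def Df (q r m : ℕ) : ℚ :=
  (q : ℚ) ^ (2 * r * m + r ^ 2) * ∏ j ∈ Finset.range m, N1 q (j + 1)

theorem span_le_rad (H : Good q F) {W : Submodule F (Fin N → F)} {v : Fin N → F}
    (hvv : herm q v v = 0) :
    F ∙ v ≤ polar q (W ⊓ polar q (F ∙ v) ⊔ F ∙ v) := by
  rw [polar_sup H]
  refine le_inf ?_ ?_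
  · rw [le_polar_comm H]; exact inf_le_right
  · exact (Submodule.span_singleton_le_iff_mem _ _).2 ((mem_polar_span H).2 hvv)

theorem GS_count (H : Good q F) {M : ℕ} (hN : N = 2 * M) :
    ∀ (k r m : ℕ) (W T : Submodule F (Fin N → F)), k = r + m → Module.finrank F W = M →
    T ≤ W ⊓ polar q W → Module.finrank F T + k = M →
    Module.finrank F ↥(W ⊓ polar q W) = Module.finrank F T + r →
    (Nat.card {μ : Submodule F (Fin N → F) // GS q M W T μ} : ℚ) = Df q r m := by
  classical
  have hq0 : (q : ℚ) ≠ 0 := by exact_mod_cast H.q_ne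
  intro k
  induction k with
  | zero =>
    intro r m W T hk hW hT hTk hR
    obtain ⟨rfl, rfl⟩ : r = 0 ∧ m = 0 := by omega
    have hTW : T = W := Submodule.eq_of_le_of_finrank_eq (hT.trans inf_le_left) (by omega)
    subst hTW
    have hTI : TotallyIsotropic q T := TI_of_le_polar (hT.trans inf_le_right)
    have : Unique {μ : Submodule F (Fin N → F) // GS q M T T μ} :=
      { default := ⟨T, hW, hTI, inf_idem _⟩
        uniq := by
          rintro ⟨μ, h1, h2, h3⟩
          apply Subtype.ext
          exact (Submodule.eq_of_le_of_finrank_eq (inf_eq_right.1 h3) (by omega)).symm }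
    simp [Df]
  | succ k ih =>
    intro r m W T hk hW hT hTk hR
    have hTp : polar q W ≤ polar q T := polar_anti (hT.trans inf_le_left)
    have hTW : T ≤ W := hT.trans inf_le_left
    have hTsup : ∀ v, v ∈ polar q T → herm q v v = 0 → T ⊔ F ∙ v ≤
        (W ⊓ polar q (F ∙ v) ⊔ F ∙ v) ⊓ polar q (W ⊓ polar q (F ∙ v) ⊔ F ∙ v) := by
      intro v hv hvv
      have h1 : T ≤ polar q (F ∙ v) := by
        rw [le_polar_comm H]; exact (Submodule.span_singleton_le_iff_mem _ _).2 hv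
      refine sup_le (le_inf (le_sup_of_le_left (le_inf hTW h1)) ?_)
        (le_inf le_sup_right (span_le_rad H hvv))
      rw [polar_sup H]
      exact le_inf (hT.trans (inf_le_right.trans (polar_anti inf_le_left))) h1
    have hWT : W ≤ polar q T := by
      rw [le_polar_comm H]; exact hT.trans inf_le_right
    have hpW := finrank_polar H W
    cases m with
    | succ m =>
      obtain ⟨e, he, hee⟩ : ∃ e ∈ polar q W, herm q e e ≠ 0 := by
        by_contra! hcon
        have h1 := TI_le_polar H (W := polar q W) hcon
        rw [polar_polar H] at h1
        rw [inf_eq_right.2 h1] at hR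
        omega
      have heW : e ∉ W := fun h => hee (mem_polar.1 he e h)
      have hstep := step H hN hW hT (hTp he) heW (Df q r m) ?_
      · have hcard : (Nat.card {v : Fin N → F // v - e ∈ W ∧ herm q v v = 0} : ℚ) =
            (q : ℚ) ^ (2 * (Module.finrank F T + r)) * N1 q (m + 1) := by
          have h1 := norm_vec_count H (m + 1) (Module.finrank F T + r) W (by omega) hR
            (-herm q e e) (by rw [H.neg, herm_self_fixed H])
          rw [if_neg (neg_ne_zero.2 hee)] at h1
          rw [← h1]
          congr 1
          have hexp : ∀ w ∈ W, herm q (w + e) (w + e) = herm q w w + herm q e e := by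
            intro w hw
            have h2 := mem_polar.1 he w hw
            rw [herm_add_left, herm_add_right H, herm_add_right H, h2, herm_eq_zero_symm H h2]
            ring
          refine Nat.card_congr
            { toFun := fun x => ⟨x.1 - e, x.2.1, ?_⟩
              invFun := fun y => ⟨y.1 + e, by simpa using y.2.1, ?_⟩
              left_inv := fun x => by simp
              right_inv := fun y => by simp }
          · have h2 := hexp (x.1 - e) x.2.1
            rw [sub_add_cancel, x.2.2] at h2
            exact eq_neg_of_add_eq_zero_left h2.symm
          · rw [hexp _ y.2.1, y.2.2, neg_add_cancel]
        rw [hcard] at hstep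
        apply mul_right_cancel₀ (pow_ne_zero (2 * Module.finrank F T) hq0)
        rw [hstep]
        simp only [Df]
        rw [Finset.prod_range_succ]
        ring
      · intro v hv hvv
        obtain ⟨w, rfl⟩ : ∃ w, v = w + e := ⟨v - e, by simp⟩
        have hw : w ∈ W := by simpa using hv
        have hwe := mem_polar.1 he w hw
        have hwe' := herm_eq_zero_symm H hwe
        have hww : herm q w w ≠ 0 := by
          intro h0
          apply hee
          rw [herm_add_left, herm_add_right H, herm_add_right H, h0, hwe, hwe'] at hvv
          simpa using hvv
        have hwW : w + e ∉ W := fun h => heW (by simpa using W.sub_mem h hw)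
        have hperp : W ⊓ polar q (F ∙ (w + e)) = W ⊓ polar q (F ∙ w) := by
          ext x
          simp only [Submodule.mem_inf, mem_polar_span H]
          refine and_congr_right fun hx => ?_
          rw [herm_add_right H, herm_eq_zero_symm H (mem_polar.1 he x hx), add_zero]
        have hvp : w + e ∉ polar q W := by
          intro h
          have := (polar q W).sub_mem h he
          rw [add_sub_cancel_right] at this
          exact hww (mem_polar.1 this w hw)
        have hd := finrank_inf_perp H hvp
        have hvT : w + e ∈ polar q T := (polar q T).add_mem (hWT hw) (hTp he)
        have hfT := finrank_sup_span (W := T) (v := w + e) (fun h => hwW (hTW h))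
        apply ih r m _ _ (by omega) _ (hTsup _ hvT hvv) (by omega)
        · rw [rad_sup H (span_le_rad H hvv), hperp, rad_cut_aniso H hw hww,
            finrank_sup_span (fun h => hwW (Submodule.mem_inf.1 h).1)]
          omega
        · rw [finrank_sup_span (fun h => hwW (Submodule.mem_inf.1 h).1)]
          omega
    | zero =>
      obtain ⟨r, rfl⟩ : ∃ r', r = r' + 1 := ⟨r - 1, by omega⟩
      have hWW : W ⊓ polar q W = W :=
        Submodule.eq_of_le_of_finrank_eq inf_le_left (by omega)
      have hWle : W ≤ polar q W := inf_eq_left.1 hWW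
      have hWpol : W = polar q W := Submodule.eq_of_le_of_finrank_eq hWle (by omega)
      obtain ⟨e, he, heW⟩ : ∃ e ∈ polar q T, e ∉ W := by
        by_contra! hcon
        have h1 := Submodule.finrank_mono (show polar q T ≤ W from hcon)
        have h2 := finrank_polar H T
        omega
      have hstep := step H hN hW hT he heW (Df q r 0) ?_
      · have hcard : (Nat.card {v : Fin N → F // v - e ∈ W ∧ herm q v v = 0} : ℚ) =
            (q : ℚ) ^ (2 * (Module.finrank F T + r) + 1) := by
          have h1 := card_trace H (W := W) (e := e) (d := Module.finrank F T + r)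
            (by rwa [← hWpol]) (by omega) (c := -herm q e e)
            (by rw [H.neg, herm_self_fixed H])
          rw [← h1]
          congr 1
          have hexp : ∀ w ∈ W, herm q (w + e) (w + e) =
              herm q w e + herm q w e ^ q + herm q e e := by
            intro w hw
            rw [herm_add_left, herm_add_right H, herm_add_right H,
              mem_polar.1 (hWle hw) w hw, herm_symm H w e]
            ring
          refine Nat.card_congr
            { toFun := fun x => ⟨x.1 - e, x.2.1, ?_⟩
              invFun := fun y => ⟨y.1 + e, by simpa using y.2.1, ?_⟩
              left_inv := fun x => by simp
              right_inv := fun y => by simp }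
          · have h2 := hexp (x.1 - e) x.2.1
            rw [sub_add_cancel, x.2.2] at h2
            exact eq_neg_of_add_eq_zero_left h2.symm
          · rw [hexp _ y.2.1, y.2.2, neg_add_cancel]
        rw [hcard] at hstep
        apply mul_right_cancel₀ (pow_ne_zero (2 * Module.finrank F T) hq0)
        rw [hstep]
        simp only [Df]
        simp only [Finset.range_zero, Finset.prod_empty]
        ring
      · intro v hv hvv
        have hvW : v ∉ W := fun h => heW (by simpa using W.sub_mem h hv)
        have hvp : v ∉ polar q W := by rwa [← hWpol]
        have hd := finrank_inf_perp H hvp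
        have hvT : v ∈ polar q T := by
          have := (polar q T).add_mem (hWT hv) he
          simpa using this
        have hfT := finrank_sup_span (W := T) (v := v) (fun h => hvW (hTW h))
        have hTI : W ⊓ polar q (F ∙ v) ≤ polar q (W ⊓ polar q (F ∙ v)) :=
          inf_le_left.trans (hWle.trans (polar_anti inf_le_left))
        apply ih r 0 _ _ (by omega) _ (hTsup _ hvT hvv) (by omega)
        · rw [rad_sup H (span_le_rad H hvv), inf_eq_left.2 hTI,
            finrank_sup_span (fun h => hvW (Submodule.mem_inf.1 h).1)]
          omega
        · rw [finrank_sup_span (fun h => hvW (Submodule.mem_inf.1 h).1)]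
          omega

end recursion

section final

variable {q : ℕ} {F : Type} [Field F] [Fintype F] {N : ℕ}

theorem card_diff_aux {α : Type*} [Finite α] (A B : α → Prop) (h : ∀ x, B x → A x) :
    (Nat.card {x // A x ∧ ¬ B x} : ℚ) = Nat.card {x // A x} - Nat.card {x // B x} := by
  classical
  have := Fintype.ofFinite α
  rw [eq_sub_iff_add_eq']
  norm_cast
  rw [← Nat.card_sum]
  refine Nat.card_congr ?_
  refine Equiv.trans ?_ (Equiv.sumCompl (fun x : {x // A x} => B x.1))
  refine Equiv.sumCongr ?_ ?_
  · exact ((Equiv.subtypeSubtypeEquivSubtypeInter A B).trans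
      (Equiv.subtypeEquivRight fun x => ⟨fun h => h.2, fun hx => ⟨h x hx, hx⟩⟩)).symm
  · exact (Equiv.subtypeSubtypeEquivSubtypeInter A (fun x => ¬ B x)).symm

theorem card_diff (H : Good q F) {U S : Submodule F (Fin N → F)} (h : S ≤ U) :
    (Nat.card {v : Fin N → F // v ∈ U ∧ v ∉ S} : ℚ) =
      (q : ℚ) ^ (2 * Module.finrank F U) - (q : ℚ) ^ (2 * Module.finrank F S) := by
  rw [card_diff_aux (fun v => v ∈ U) (fun v => v ∈ S) (fun x hx => h hx)]
  have h1 := card_sub H U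
  have h2 := card_sub H S
  rw [← Nat.cast_pow, ← Nat.cast_pow, ← h1, ← h2]

/-- The isotropic vectors orthogonal to `a` outside of the radical of `a^⊥`. -/
def XX (q : ℕ) (W : Submodule F (Fin N → F)) (a v : Fin N → F) : Prop :=
  (v ∈ W ⊓ polar q (F ∙ a) ∧ herm q v v = 0) ∧ v ∉ W ⊓ polar q W ⊔ F ∙ a

theorem card_XX (H : Good q F) {W : Submodule F (Fin N → F)} {a : Fin N → F} {r k : ℕ}
    (hW : Module.finrank F W = r + k + 2) (hR : Module.finrank F ↥(W ⊓ polar q W) = r)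
    (ha : a ∈ W) (hap : a ∉ polar q W) (haa : herm q a a = 0) :
    (Nat.card {v // XX q W a v} : ℚ) = (q : ℚ) ^ (2 * (r + 1)) * (N0 q k - 1) := by
  have hrad := rad_cut_iso H ha haa
  have hfr : Module.finrank F ↥(W ⊓ polar q W ⊔ F ∙ a) = r + 1 := by
    rw [finrank_sup_span (fun h => hap (Submodule.mem_inf.1 h).2), hR]
  have hd := finrank_inf_perp H hap
  unfold XX
  rw [card_diff_aux (fun v => v ∈ W ⊓ polar q (F ∙ a) ∧ herm q v v = 0)
    (fun v => v ∈ W ⊓ polar q W ⊔ F ∙ a)]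
  · rw [norm_vec_count H k (r + 1) (W ⊓ polar q (F ∙ a)) (by omega) (by rw [hrad, hfr]) 0
      (zero_pow H.q_ne), if_pos rfl]
    have h2 := card_sub H (W ⊓ polar q W ⊔ F ∙ a)
    rw [hfr] at h2
    have h3 : (Nat.card {x // x ∈ W ⊓ polar q W ⊔ F ∙ a} : ℚ) = (q : ℚ) ^ (2 * (r + 1)) := by
      exact_mod_cast h2
    rw [h3]
    ring
  · intro x hx
    rw [← hrad] at hx
    exact ⟨hx.1, mem_polar.1 hx.2 x hx.1⟩

/-- The generators to be counted. -/
def GG (q M : ℕ) (W : Submodule F (Fin N → F)) (p : Fin N → F) (μ : Submodule F (Fin N → F)) :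
    Prop :=
  Module.finrank F μ = M ∧ TotallyIsotropic q μ ∧ p ∈ μ ∧ Module.finrank F ↥(μ ⊓ W) = 1 ∧
    μ ⊓ (W ⊓ polar q W) = ⊥

theorem eq_span_of_finrank_one {U : Submodule F (Fin N → F)} (h : Module.finrank F U = 1)
    {v : Fin N → F} (hv : v ∈ U) (h0 : v ≠ 0) : U = F ∙ v := by
  symm
  apply Submodule.eq_of_le_of_finrank_eq ((Submodule.span_singleton_le_iff_mem _ _).2 hv)
  rw [finrank_span_singleton h0, h]

theorem polar_gen (H : Good q F) {M : ℕ} (hN : N = 2 * M) {μ : Submodule F (Fin N → F)}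
    (h1 : Module.finrank F μ = M) (h2 : TotallyIsotropic q μ) : polar q μ = μ := by
  symm
  apply Submodule.eq_of_le_of_finrank_eq (TI_le_polar H h2)
  have := finrank_polar H μ
  omega

theorem finrank_inf_polar (H : Good q F) {M : ℕ} (hN : N = 2 * M) {μ W : Submodule F (Fin N → F)}
    (h1 : Module.finrank F μ = M) (h2 : TotallyIsotropic q μ) (hW : Module.finrank F W = M) :
    Module.finrank F ↥(μ ⊓ polar q W) = Module.finrank F ↥(μ ⊓ W) := by
  have h3 := finrank_polar H (μ ⊔ W)
  rw [polar_sup H, polar_gen H hN h1 h2] at h3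
  have h4 := Submodule.finrank_sup_add_finrank_inf_eq μ W
  omega

theorem inf_perp_add (H : Good q F) {W : Submodule F (Fin N → F)} {a b : Fin N → F}
    (hb : b ∈ polar q W) : W ⊓ polar q (F ∙ (a + b)) = W ⊓ polar q (F ∙ a) := by
  ext x
  simp only [Submodule.mem_inf, mem_polar_span H]
  refine and_congr_right fun hx => ?_
  rw [herm_add_right H, herm_eq_zero_symm H (mem_polar.1 hb x hx), add_zero]

section count

variable {M r k : ℕ} {W : Submodule F (Fin N → F)} {a b : Fin N → F}

theorem case_one (H : Good q F) (hN : N = 2 * M) (hW : Module.finrank F W = M)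
    (hM : M = r + k + 2) (hR : Module.finrank F ↥(W ⊓ polar q W) = r)
    (ha : a ∈ W) (hap : a ∉ polar q W) (haa : herm q a a = 0)
    (hb : b ∈ polar q W) (hbW : b ∉ W) (hbb : herm q b b = 0) :
    (Nat.card {μ // GG q M W (a + b) μ ∧ μ ⊓ W ≤ W ⊓ polar q W ⊔ F ∙ a} : ℚ) =
      (q : ℚ) ^ (2 * r) * Df q r k := by
  have hrad := rad_cut_iso H ha haa
  have hfr : Module.finrank F ↥(W ⊓ polar q W ⊔ F ∙ a) = r + 1 := by
    rw [finrank_sup_span (fun h => hap (Submodule.mem_inf.1 h).2), hR]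
  have hd := finrank_inf_perp H hap
  have hpW : a + b ∉ W := fun h => hbW (by simpa using W.sub_mem h ha)
  have hperp := inf_perp_add H (a := a) hb
  have hab := herm_eq_zero_symm H (mem_polar.1 hb a ha)
  have hpp : herm q (a + b) (a + b) = 0 := by
    rw [herm_add_left, herm_add_right H, herm_add_right H, haa, hbb, hab,
      mem_polar.1 hb a ha]
    ring
  have hRaW : W ⊓ polar q W ⊔ F ∙ a ≤ W :=
    sup_le inf_le_left ((Submodule.span_singleton_le_iff_mem _ _).2 ha)
  have hRaa : W ⊓ polar q W ⊔ F ∙ a ≤ W ⊓ polar q (F ∙ a) := by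
    rw [← hrad]; exact inf_le_left
  have hq1 : (q : ℚ) ^ 2 - 1 ≠ 0 := by
    have : (2 : ℚ) ≤ q := by exact_mod_cast H.two_le
    nlinarith
  have key := double_count (α := {μ // GG q M W (a + b) μ ∧ μ ⊓ W ≤ W ⊓ polar q W ⊔ F ∙ a})
    (β := {v // v ∈ W ⊓ polar q W ⊔ F ∙ a ∧ v ∉ W ⊓ polar q W}) (fun μ v => v.1 ∈ μ.1)
    ((q : ℚ) ^ 2 - 1) (Df q r k) ?_ ?_
  · rw [card_diff H le_sup_left, hfr, hR] at key
    apply mul_right_cancel₀ hq1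
    rw [key]
    ring
  · rintro ⟨μ, ⟨h1, h2, h3, h4, h5⟩, h6⟩
    have h7 := card_diff H (U := μ ⊓ W) (S := ⊥) bot_le
    rw [h4, finrank_bot] at h7
    simp only [mul_one, mul_zero, pow_zero] at h7
    rw [← h7]
    congr 1
    refine card_sub_sub (A := fun v => v ∈ W ⊓ polar q W ⊔ F ∙ a ∧ v ∉ W ⊓ polar q W)
      (B := fun v => v ∈ μ) fun v => ?_
    constructor
    · rintro ⟨⟨h8, h9⟩, h10⟩
      refine ⟨⟨h10, hRaW h8⟩, fun h0 => h9 ?_⟩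
      rw [(Submodule.mem_bot F).1 h0]; exact Submodule.zero_mem _
    · rintro ⟨h8, h9⟩
      refine ⟨⟨h6 h8, fun h10 => h9 ?_⟩, h8.1⟩
      rw [← h5]
      exact ⟨h8.1, h10⟩
  · rintro ⟨v, hv, hvR⟩
    have hv0 : v ≠ 0 := fun h => hvR (h ▸ Submodule.zero_mem _)
    have hvW := hRaW hv
    have hvp : (a + b) ∉ F ∙ v := fun h =>
      hpW ((Submodule.span_singleton_le_iff_mem _ _).2 hvW h)
    have hfT : Module.finrank F ↥(F ∙ v ⊔ F ∙ (a + b)) = 2 := by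
      rw [finrank_sup_span hvp, finrank_span_singleton hv0]
    have hrad1 : (W ⊓ polar q (F ∙ (a + b)) ⊔ F ∙ (a + b)) ⊓
        polar q (W ⊓ polar q (F ∙ (a + b)) ⊔ F ∙ (a + b)) =
        (W ⊓ polar q W ⊔ F ∙ a) ⊔ F ∙ (a + b) := by
      rw [rad_sup H (span_le_rad H hpp), hperp, hrad]
    have hcount := GS_count H hN (r + k) r k (W ⊓ polar q (F ∙ (a + b)) ⊔ F ∙ (a + b))
      (F ∙ v ⊔ F ∙ (a + b)) rfl
      (by rw [hperp, finrank_sup_span (fun h => hpW (Submodule.mem_inf.1 h).1)]; omega)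
      (by
        rw [hrad1]
        exact sup_le_sup_right ((Submodule.span_singleton_le_iff_mem _ _).2 hv) _)
      (by omega)
      (by rw [hrad1, finrank_sup_span (fun h => hpW (hRaW h)), hfr, hfT]; omega)
    rw [← hcount]
    congr 1
    refine card_sub_sub
      (A := fun μ => GG q M W (a + b) μ ∧ μ ⊓ W ≤ W ⊓ polar q W ⊔ F ∙ a)
      (B := fun μ => v ∈ μ) fun μ => ?_
    constructor
    · rintro ⟨⟨⟨h1, h2, h3, h4, h5⟩, h6⟩, h7⟩
      have h8 := eq_span_of_finrank_one h4 ⟨h7, hvW⟩ hv0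
      refine ⟨h1, h2, le_antisymm ?_ ?_⟩
      · rintro x ⟨hx1, hx2⟩
        obtain ⟨y, hy, z, hz, rfl⟩ := Submodule.mem_sup.1 hx2
        refine Submodule.add_mem_sup ?_ hz
        rw [← h8]
        refine ⟨?_, hy.1⟩
        obtain ⟨c, rfl⟩ := Submodule.mem_span_singleton.1 hz
        have := μ.sub_mem hx1 (μ.smul_mem c h3)
        simpa using this
      · refine le_inf (sup_le ?_ ?_) (sup_le_sup_right ?_ _)
        · exact (Submodule.span_singleton_le_iff_mem _ _).2 h7
        · exact (Submodule.span_singleton_le_iff_mem _ _).2 h3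
        · rw [hperp]
          exact (Submodule.span_singleton_le_iff_mem _ _).2 (hRaa hv)
    · rintro ⟨h1, h2, h3⟩
      have h4 : F ∙ v ⊔ F ∙ (a + b) ≤ μ := h3 ▸ inf_le_left
      have h5 : v ∈ μ := h4 (Submodule.mem_sup_left (Submodule.mem_span_singleton_self v))
      have h6 : a + b ∈ μ := h4 (Submodule.mem_sup_right (Submodule.mem_span_singleton_self _))
      have h7 : μ ⊓ W = F ∙ v := by
        apply le_antisymm
        · rintro x ⟨hx1, hx2⟩
          have hx3 : x ∈ F ∙ v ⊔ F ∙ (a + b) := by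
            rw [← h3]
            exact ⟨hx1, Submodule.mem_sup_left ⟨hx2,
              (mem_polar_span H).2 (mem_polar.1 (TI_le_polar H h2 hx1) _ h6)⟩⟩
          obtain ⟨t, ht, z, hz, rfl⟩ := Submodule.mem_sup.1 hx3
          obtain ⟨c, rfl⟩ := Submodule.mem_span_singleton.1 hz
          have h8 : c • (a + b) ∈ W := by
            have := W.sub_mem hx2 ((Submodule.span_singleton_le_iff_mem _ _).2 hvW ht)
            simpa using this
          have hc : c = 0 := by
            by_contra hc
            exact hpW ((Submodule.smul_mem_iff _ hc).1 h8)
          simpa [hc] using ht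
        · exact (Submodule.span_singleton_le_iff_mem _ _).2 ⟨h5, hvW⟩
      refine ⟨⟨⟨h1, h2, h6, ?_, ?_⟩, ?_⟩, h5⟩
      · rw [h7, finrank_span_singleton hv0]
      · rw [← inf_assoc, h7, eq_bot_iff]
        rintro x ⟨hx1, hx2⟩
        obtain ⟨c, rfl⟩ := Submodule.mem_span_singleton.1 hx1
        by_cases hc : c = 0
        · simp [hc]
        · exact absurd ⟨hvW, (Submodule.smul_mem_iff _ hc).1 hx2⟩ hvR
      · rw [h7]
        exact (Submodule.span_singleton_le_iff_mem _ _).2 hv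

theorem case_two (H : Good q F) (hN : N = 2 * M) (hW : Module.finrank F W = M)
    (hM : M = r + (k + 2) + 2) (hR : Module.finrank F ↥(W ⊓ polar q W) = r)
    (ha : a ∈ W) (hap : a ∉ polar q W) (haa : herm q a a = 0)
    (hb : b ∈ polar q W) (hbW : b ∉ W) (hbb : herm q b b = 0) :
    (Nat.card {μ // GG q M W (a + b) μ ∧ ¬ μ ⊓ W ≤ W ⊓ polar q W ⊔ F ∙ a} : ℚ) *
      ((q : ℚ) ^ 2 - 1) ^ 2 =
      ((q : ℚ) ^ (2 * (r + 1)) * (N0 q (k + 2) - 1)) ^ 2 * Df q (r + 1) k := by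
  have hrad := rad_cut_iso H ha haa
  have hfr : Module.finrank F ↥(W ⊓ polar q W ⊔ F ∙ a) = r + 1 := by
    rw [finrank_sup_span (fun h => hap (Submodule.mem_inf.1 h).2), hR]
  have hd := finrank_inf_perp H hap
  have hpW : a + b ∉ W := fun h => hbW (by simpa using W.sub_mem h ha)
  have hperp := inf_perp_add H (a := a) hb
  have hab := herm_eq_zero_symm H (mem_polar.1 hb a ha)
  have hpp : herm q (a + b) (a + b) = 0 := by
    rw [herm_add_left, herm_add_right H, herm_add_right H, haa, hbb, hab,
      mem_polar.1 hb a ha]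
    ring
  have hRaW : W ⊓ polar q W ⊔ F ∙ a ≤ W :=
    sup_le inf_le_left ((Submodule.span_singleton_le_iff_mem _ _).2 ha)
  have hRpol : polar q W ⊓ polar q (polar q W) = W ⊓ polar q W := by
    rw [polar_polar H, inf_comm]
  have hWpol : Module.finrank F ↥(polar q W) = M := by
    have := finrank_polar H W
    omega
  have hXa := card_XX H (by omega : Module.finrank F W = r + (k + 2) + 2) hR ha hap haa
  have hXb := card_XX H (by omega : Module.finrank F ↥(polar q W) = r + (k + 2) + 2)
    (by rw [hRpol, hR]) hb (by rwa [polar_polar H]) hbb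
  have key := double_count (α := {μ // GG q M W (a + b) μ ∧ ¬ μ ⊓ W ≤ W ⊓ polar q W ⊔ F ∙ a})
    (β := {v // XX q W a v} × {u // XX q (polar q W) b u})
    (fun μ z => z.1.1 ∈ μ.1 ∧ z.2.1 ∈ μ.1)
    (((q : ℚ) ^ 2 - 1) ^ 2) (Df q (r + 1) k) ?_ ?_
  · rw [key, Nat.card_prod]
    push_cast
    rw [hXa, hXb]
    ring
  · rintro ⟨μ, ⟨h1, h2, h3, h4, h5⟩, h6⟩
    have h4' : Module.finrank F ↥(μ ⊓ polar q W) = 1 := by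
      rw [finrank_inf_polar H hN h1 h2 hW, h4]
    have h7 := card_diff H (U := μ ⊓ W) (S := ⊥) bot_le
    have h8 := card_diff H (U := μ ⊓ polar q W) (S := ⊥) bot_le
    rw [h4, finrank_bot] at h7
    rw [h4', finrank_bot] at h8
    simp only [mul_one, mul_zero, pow_zero] at h7 h8
    have hμp := TI_le_polar H h2
    have hv : ∀ v, v ∈ μ ⊓ W ∧ v ∉ (⊥ : Submodule F (Fin N → F)) ↔ XX q W a v ∧ v ∈ μ := by
      intro v
      constructor
      · rintro ⟨hv1, hv2⟩
        have hv0 : v ≠ 0 := by simpa using hv2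
        refine ⟨⟨⟨?_, h2 v hv1.1⟩, ?_⟩, hv1.1⟩
        · rw [← hperp]
          exact ⟨hv1.2, (mem_polar_span H).2 (mem_polar.1 (hμp hv1.1) _ h3)⟩
        · intro hv3
          apply h6
          rw [eq_span_of_finrank_one h4 hv1 hv0]
          exact (Submodule.span_singleton_le_iff_mem _ _).2 hv3
      · rintro ⟨⟨⟨hv1, hv2⟩, hv3⟩, hv4⟩
        refine ⟨⟨hv4, hv1.1⟩, fun h0 => hv3 ?_⟩
        rw [(Submodule.mem_bot F).1 h0]; exact Submodule.zero_mem _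
    have hu : ∀ u, u ∈ μ ⊓ polar q W ∧ u ∉ (⊥ : Submodule F (Fin N → F)) ↔
        XX q (polar q W) b u ∧ u ∈ μ := by
      intro u
      constructor
      · rintro ⟨hu1, hu2⟩
        have hu0 : u ≠ 0 := by simpa using hu2
        refine ⟨⟨⟨⟨hu1.2, ?_⟩, h2 u hu1.1⟩, ?_⟩, hu1.1⟩
        · have := mem_polar.1 (hμp hu1.1) _ h3
          rw [herm_add_right H, mem_polar.1 hu1.2 a ha, zero_add] at this
          exact (mem_polar_span H).2 this
        · rw [hRpol]
          intro hu3
          obtain ⟨ρ, hρ, z, hz, rfl⟩ := Submodule.mem_sup.1 hu3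
          obtain ⟨c, rfl⟩ := Submodule.mem_span_singleton.1 hz
          have hc : c ≠ 0 := by
            rintro rfl
            apply hu2
            rw [← h5]
            refine ⟨hu1.1, ?_⟩
            simpa using hρ
          have hx : c • a - ρ ∈ μ ⊓ W := by
            refine ⟨?_, W.sub_mem (W.smul_mem _ ha) hρ.1⟩
            have := μ.sub_mem (μ.smul_mem c h3) hu1.1
            rw [SetLike.mem_coe]
            convert this using 1
            rw [smul_add]
            abel
          have hx0 : c • a - ρ ≠ 0 := by
            intro h0
            have h9 : c • a ∈ polar q W := by
              rw [sub_eq_zero.1 h0]; exact hρ.2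
            exact hap ((Submodule.smul_mem_iff _ hc).1 h9)
          apply h6
          rw [eq_span_of_finrank_one h4 hx hx0, Submodule.span_singleton_le_iff_mem]
          exact Submodule.sub_mem _
            (Submodule.mem_sup_right (Submodule.smul_mem _ _ (Submodule.mem_span_singleton_self a)))
            (Submodule.mem_sup_left hρ)
      · rintro ⟨⟨⟨hv1, hv2⟩, hv3⟩, hv4⟩
        refine ⟨⟨hv4, hv1.1⟩, fun h0 => hv3 ?_⟩
        rw [(Submodule.mem_bot F).1 h0]; exact Submodule.zero_mem _
    rw [sq, ← h7]
    nth_rewrite 2 [h7]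
    rw [← h8, ← Nat.cast_mul, ← Nat.card_prod]
    congr 1
    exact Nat.card_congr
      { toFun := fun z => ⟨⟨z.1.1.1, (hv _).2 ⟨z.1.1.2, z.2.1⟩⟩, ⟨z.1.2.1, (hu _).2 ⟨z.1.2.2, z.2.2⟩⟩⟩
        invFun := fun z => ⟨⟨⟨z.1.1, ((hv _).1 z.1.2).1⟩, ⟨z.2.1, ((hu _).1 z.2.2).1⟩⟩,
          ((hv _).1 z.1.2).2, ((hu _).1 z.2.2).2⟩
        left_inv := fun _ => rfl
        right_inv := fun _ => rfl }
  · rintro ⟨⟨v, ⟨hv1, hvv⟩, hv2⟩, ⟨u, ⟨hu1, huu⟩, hu2⟩⟩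
    rw [hRpol] at hu2
    have hvW := hv1.1
    have hva := (mem_polar_span H).1 hv1.2
    have hub := (mem_polar_span H).1 hu1.2
    have hv0 : v ≠ 0 := fun h => hv2 (h ▸ Submodule.zero_mem _)
    have hvR : v ∉ polar q W := fun h => hv2 (Submodule.mem_sup_left ⟨hvW, h⟩)
    have hua : herm q u a = 0 := mem_polar.1 hu1.1 a ha
    have huv : herm q u v = 0 := mem_polar.1 hu1.1 v hvW
    have hup : herm q u (a + b) = 0 := by rw [herm_add_right H, hua, hub, add_zero]
    -- independence of `u`, `a + b` modulo `W`
    have hind : ∀ c d : F, c • u + d • (a + b) ∈ W → c = 0 ∧ d = 0 := by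
      intro c d h
      have h1 : c • u + d • b ∈ W := by
        have := W.sub_mem h (W.smul_mem d ha)
        convert this using 1
        rw [smul_add]; abel
      have h2 : c • u + d • b ∈ polar q W :=
        Submodule.add_mem _ (Submodule.smul_mem _ _ hu1.1) (Submodule.smul_mem _ _ hb)
      have hc : c = 0 := by
        by_contra hc
        apply hu2
        have h3 : c • u ∈ W ⊓ polar q W ⊔ F ∙ b := by
          have : c • u = (c • u + d • b) + (-d) • b := by rw [neg_smul]; abel
          rw [this]
          exact Submodule.add_mem_sup ⟨h1, h2⟩
            (Submodule.smul_mem _ _ (Submodule.mem_span_singleton_self b))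
        exact (Submodule.smul_mem_iff _ hc).1 h3
      refine ⟨hc, ?_⟩
      by_contra hd0
      rw [hc, zero_smul, zero_add] at h1
      exact hbW ((Submodule.smul_mem_iff _ hd0).1 h1)
    have huW : u ∉ W := fun h => one_ne_zero (hind 1 0 (by simpa using h)).1
    have hpWu : a + b ∉ W ⊔ F ∙ u := by
      intro h
      obtain ⟨w, hw, z, hz, hwz⟩ := Submodule.mem_sup.1 h
      obtain ⟨c, rfl⟩ := Submodule.mem_span_singleton.1 hz
      refine one_ne_zero (hind (-c) 1 ?_).2
      rw [one_smul, ← hwz, neg_smul]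
      simpa using hw
    have hfin2 : ∀ Y : Submodule F (Fin N → F), Y ≤ W →
        Module.finrank F ↥(Y ⊔ (F ∙ u ⊔ F ∙ (a + b))) = Module.finrank F Y + 2 := by
      intro Y hY
      rw [← sup_assoc, finrank_sup_span (fun h => hpWu (sup_le_sup_right hY _ h)),
        finrank_sup_span (fun h => huW (hY h))]
    set X := (W ⊓ polar q (F ∙ a)) ⊓ polar q (F ∙ v) with hX
    have hXW : X ≤ W := inf_le_left.trans inf_le_left
    have hvpol : v ∉ polar q (W ⊓ polar q (F ∙ a)) := by
      intro h
      apply hv2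
      rw [← hrad]
      exact ⟨hv1, h⟩
    have hXfr := finrank_inf_perp H hvpol
    rw [← hX] at hXfr
    have hradX : X ⊓ polar q X = (W ⊓ polar q W ⊔ F ∙ a) ⊔ F ∙ v := by
      rw [hX, rad_cut_iso H hv1 hvv, hrad]
    have hT0 : F ∙ u ⊔ F ∙ (a + b) ≤ polar q (X ⊔ (F ∙ u ⊔ F ∙ (a + b))) := by
      rw [le_polar_comm H, polar_sup H]
      refine sup_le ?_ (sup_le ?_ ?_)
      · intro x hx
        refine ⟨(mem_polar_span H).2 (herm_eq_zero_symm H (mem_polar.1 hu1.1 x (hXW hx))),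
          (mem_polar_span H).2 ?_⟩
        rw [herm_add_right H, (mem_polar_span H).1 hx.1.2,
          herm_eq_zero_symm H (mem_polar.1 hb x (hXW hx)), add_zero]
      · rw [Submodule.span_singleton_le_iff_mem]
        exact ⟨(mem_polar_span H).2 huu, (mem_polar_span H).2 hup⟩
      · rw [Submodule.span_singleton_le_iff_mem]
        exact ⟨(mem_polar_span H).2 (herm_eq_zero_symm H hup), (mem_polar_span H).2 hpp⟩
    have hradW := rad_sup H hT0
    rw [hradX] at hradW
    have hfT : Module.finrank F ↥(F ∙ v ⊔ (F ∙ u ⊔ F ∙ (a + b))) = 3 := by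
      rw [hfin2 _ ((Submodule.span_singleton_le_iff_mem _ _).2 hvW), finrank_span_singleton hv0]
    have hvX : F ∙ v ≤ X := by
      rw [Submodule.span_singleton_le_iff_mem]
      exact ⟨hv1, (mem_polar_span H).2 hvv⟩
    have hcount := GS_count H hN (r + 1 + k) (r + 1) k (X ⊔ (F ∙ u ⊔ F ∙ (a + b)))
      (F ∙ v ⊔ (F ∙ u ⊔ F ∙ (a + b))) rfl
      (by rw [hfin2 _ hXW]; omega)
      (by rw [hradW]; exact sup_le_sup_right le_sup_right _)
      (by omega)
      (by
        rw [hradW, hfin2 _ (sup_le hRaW ((Submodule.span_singleton_le_iff_mem _ _).2 hvW)),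
          finrank_sup_span hv2, hfr, hfT]
        omega)
    rw [← hcount]
    congr 1
    refine card_sub_sub
      (A := fun μ => GG q M W (a + b) μ ∧ ¬ μ ⊓ W ≤ W ⊓ polar q W ⊔ F ∙ a)
      (B := fun μ => v ∈ μ ∧ u ∈ μ) fun μ => ?_
    constructor
    · rintro ⟨⟨⟨h1, h2, h3, h4, h5⟩, h6⟩, h7, h7'⟩
      have h8 := eq_span_of_finrank_one h4 ⟨h7, hvW⟩ hv0
      have hT0μ : F ∙ u ⊔ F ∙ (a + b) ≤ μ :=
        sup_le ((Submodule.span_singleton_le_iff_mem _ _).2 h7')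
          ((Submodule.span_singleton_le_iff_mem _ _).2 h3)
      refine ⟨h1, h2, le_antisymm ?_ ?_⟩
      · rintro x ⟨hx1, hx2⟩
        obtain ⟨y, hy, z, hz, rfl⟩ := Submodule.mem_sup.1 hx2
        refine Submodule.add_mem_sup ?_ hz
        rw [← h8]
        refine ⟨?_, hXW hy⟩
        have := μ.sub_mem hx1 (hT0μ hz)
        simpa using this
      · exact le_inf (sup_le ((Submodule.span_singleton_le_iff_mem _ _).2 h7) hT0μ)
          (sup_le_sup_right hvX _)
    · rintro ⟨h1, h2, h3⟩
      have h4 : F ∙ v ⊔ (F ∙ u ⊔ F ∙ (a + b)) ≤ μ := h3 ▸ inf_le_left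
      have h5 : v ∈ μ := h4 (Submodule.mem_sup_left (Submodule.mem_span_singleton_self v))
      have h6 : u ∈ μ := h4 (Submodule.mem_sup_right
        (Submodule.mem_sup_left (Submodule.mem_span_singleton_self _)))
      have h6' : a + b ∈ μ := h4 (Submodule.mem_sup_right
        (Submodule.mem_sup_right (Submodule.mem_span_singleton_self _)))
      have h7 : μ ⊓ W = F ∙ v := by
        apply le_antisymm
        · rintro x ⟨hx1, hx2⟩
          have hxp := TI_le_polar H h2 hx1
          have hx3 : x ∈ F ∙ v ⊔ (F ∙ u ⊔ F ∙ (a + b)) := by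
            rw [← h3]
            refine ⟨hx1, Submodule.mem_sup_left ⟨?_, (mem_polar_span H).2 (mem_polar.1 hxp v h5)⟩⟩
            rw [SetLike.mem_coe, ← hperp]
            exact ⟨hx2, (mem_polar_span H).2 (mem_polar.1 hxp _ h6')⟩
          obtain ⟨t, ht, z, hz, rfl⟩ := Submodule.mem_sup.1 hx3
          obtain ⟨z1, hz1, z2, hz2, rfl⟩ := Submodule.mem_sup.1 hz
          obtain ⟨c, rfl⟩ := Submodule.mem_span_singleton.1 hz1
          obtain ⟨d, rfl⟩ := Submodule.mem_span_singleton.1 hz2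
          have h8 : c • u + d • (a + b) ∈ W := by
            have := W.sub_mem hx2 ((Submodule.span_singleton_le_iff_mem _ _).2 hvW ht)
            simpa using this
          obtain ⟨hc, hd0⟩ := hind c d h8
          simpa [hc, hd0] using ht
        · exact (Submodule.span_singleton_le_iff_mem _ _).2 ⟨h5, hvW⟩
      refine ⟨⟨⟨h1, h2, h6', ?_, ?_⟩, ?_⟩, h5, h6⟩
      · rw [h7, finrank_span_singleton hv0]
      · rw [← inf_assoc, h7, eq_bot_iff]
        rintro x ⟨hx1, hx2⟩
        obtain ⟨c, rfl⟩ := Submodule.mem_span_singleton.1 hx1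
        by_cases hc : c = 0
        · simp [hc]
        · exact absurd ((Submodule.smul_mem_iff _ hc).1 hx2) hvR
      · rw [h7, Submodule.span_singleton_le_iff_mem]
        exact hv2

end count

end final

section assembly

theorem choose_sq (t : ℕ) : t.choose 2 + (t + 1).choose 2 = t ^ 2 := by
  induction t with
  | zero => simp
  | succ t ih =>
    have h1 : (t + 1 + 1).choose 2 = (t + 1).choose 1 + (t + 1).choose 2 := Nat.choose_succ_succ _ _
    have h2 : (t + 1).choose 2 = t.choose 1 + t.choose 2 := Nat.choose_succ_succ _ _
    simp only [Nat.choose_one_right] at h1 h2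
    nlinarith

theorem prod_N1 {q : ℕ} (hq0 : (q : ℚ) ≠ 0) (t : ℕ) :
    ∏ j ∈ Finset.range t, N1 q (j + 1) =
      (q : ℚ) ^ (t.choose 2) * ∏ j ∈ Finset.range t, ((q : ℚ) ^ (j + 1) - (-1 : ℚ) ^ (j + 1)) := by
  induction t with
  | zero => simp
  | succ t ih =>
    have h2 : (t + 1).choose 2 = t.choose 1 + t.choose 2 := Nat.choose_succ_succ _ _
    rw [Nat.choose_one_right] at h2
    rw [Finset.prod_range_succ, Finset.prod_range_succ, ih, h2, N1]
    field_simp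
    ring

theorem NN_eq {q : ℕ} (hq0 : (q : ℚ) ≠ 0) (t r : ℕ) :
    NN q (t + r + 2) (r : ℤ) = (q : ℚ) ^ (2 * (r + 1) * t + (r + 1) ^ 2) *
      ∏ j ∈ Finset.range t, N1 q (j + 1) := by
  rw [prod_N1 hq0, NN]
  have e1 : (((t + r + 2 : ℕ) : ℤ) - r - 1).toNat = t + 1 := by omega
  have e2 : (((t + r + 2 : ℕ) : ℤ) - r - 2).toNat = t := by omega
  rw [e1, e2, ← mul_assoc, ← pow_add, ← zpow_natCast]
  congr 2
  have h := choose_sq t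
  zify at h
  push_cast
  nlinarith

theorem muH_eq {q : ℕ} (t : ℕ) :
    muH q ((t : ℤ) + 1) = (((q : ℚ) ^ (t + 2) - (-1) ^ (t + 2)) * ((q : ℚ) ^ (t + 1) - (-1) ^ (t + 1)))
      / ((q : ℚ) ^ 2 - 1) := by
  rw [muH]
  norm_cast

theorem final_algebra {q : ℕ} (hq2 : 2 ≤ q) (t r : ℕ) (c2 : ℚ)
    (h2 : c2 * ((q : ℚ) ^ 2 - 1) ^ 2 =
      ((q : ℚ) ^ (2 * (r + 1)) * (N0 q (t + 2) - 1)) ^ 2 * Df q (r + 1) t) :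
    (q : ℚ) ^ (2 * r) * Df q r (t + 2) + c2 =
      NN q (t + r + 2) (r : ℤ) * (q : ℚ) ^ (4 * r) * muH q ((t : ℤ) + 1)
          * ((q : ℚ) ^ 4 * muH q ((t : ℤ) + 1) + (q : ℚ) ^ 2 - 1) := by
  have hq0 : (q : ℚ) ≠ 0 := by
    have : q ≠ 0 := by omega
    exact_mod_cast this
  have hq1 : (q : ℚ) ^ 2 - 1 ≠ 0 := by
    have : (2 : ℚ) ≤ q := by exact_mod_cast hq2
    nlinarith
  have hs : ((-1 : ℚ) ^ t) * (-1) ^ t = 1 := by rw [← mul_pow]; simp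
  have hm : muH q ((t : ℤ) + 1) * ((q : ℚ) ^ 2 - 1) =
      ((q : ℚ) ^ (t + 2) - (-1) ^ (t + 2)) * ((q : ℚ) ^ (t + 1) - (-1) ^ (t + 1)) := by
    rw [muH_eq, div_mul_cancel₀ _ hq1]
  have hN0 : N0 q (t + 2) - 1 = muH q ((t : ℤ) + 1) * ((q : ℚ) ^ 2 - 1) := by
    rw [hm, N0]
    field_simp
    linear_combination (q : ℚ) * hs
  have hNN : N1 q (t + 1) * N1 q (t + 2) =
      (q : ℚ) ^ (2 * t + 1) * (muH q ((t : ℤ) + 1) * ((q : ℚ) ^ 2 - 1)) := by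
    rw [hm, N1, N1]
    field_simp
    ring
  have hc2 : c2 = ((q : ℚ) ^ (2 * (r + 1)) * muH q ((t : ℤ) + 1)) ^ 2 * Df q (r + 1) t := by
    apply mul_right_cancel₀ (pow_ne_zero 2 hq1)
    rw [h2, hN0]
    ring
  rw [hc2, NN_eq hq0]
  simp only [Df]
  rw [Finset.prod_range_succ, Finset.prod_range_succ, mul_assoc (∏ j ∈ Finset.range t, N1 q (j + 1)),
    hNN]
  ring

variable {q : ℕ} {F : Type} [Field F] [Fintype F] {N : ℕ}

theorem exu_iff (U S : Submodule F (Fin N → F)) :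
    (∃! R : Submodule F (Fin N → F), Module.finrank F R = 1 ∧ R ≤ U ∧ ¬ R ≤ S) ↔
      Module.finrank F U = 1 ∧ U ⊓ S = ⊥ := by
  constructor
  · rintro ⟨R, ⟨h1, h2, h3⟩, huniq⟩
    obtain ⟨x, hxR, hxS⟩ := SetLike.not_le_iff_exists.1 h3
    have hkey : ∀ y ∈ U, y ∉ S → y ∈ R := by
      intro y hy hyS
      have hy0 : y ≠ 0 := fun h => hyS (h ▸ S.zero_mem)
      have := huniq (F ∙ y) ⟨finrank_span_singleton hy0,
        (Submodule.span_singleton_le_iff_mem _ _).2 hy,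
        fun h => hyS ((Submodule.span_singleton_le_iff_mem _ _).1 h)⟩
      rw [← this]
      exact Submodule.mem_span_singleton_self y
    have hUR : U = R := by
      apply le_antisymm _ h2
      intro y hy
      by_cases hyS : y ∈ S
      · have := hkey (x + y) (U.add_mem (h2 hxR) hy)
          (fun h => hxS (by simpa using S.sub_mem h hyS))
        simpa using R.sub_mem this hxR
      · exact hkey y hy hyS
    subst hUR
    refine ⟨h1, ?_⟩
    have hx0 : x ≠ 0 := fun h => hxS (h ▸ S.zero_mem)
    rw [eq_bot_iff]
    rintro y ⟨hy1, hy2⟩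
    rw [eq_span_of_finrank_one h1 hxR hx0] at hy1
    obtain ⟨c, rfl⟩ := Submodule.mem_span_singleton.1 hy1
    by_cases hc : c = 0
    · simp [hc]
    · exact absurd ((Submodule.smul_mem_iff _ hc).1 hy2) hxS
  · rintro ⟨h1, h2⟩
    refine ⟨U, ⟨h1, le_rfl, fun h => ?_⟩, fun R hR =>
      Submodule.eq_of_le_of_finrank_eq hR.2.1 (by rw [hR.1, h1])⟩
    rw [inf_eq_left.2 h] at h2
    rw [h2, finrank_bot] at h1
    exact zero_ne_one h1

theorem good_line (H : Good q F) {π P : Submodule F (Fin N → F)} (hP : IsHermPoint q P)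
    (hPπ : ¬ P ≤ π) (hPσ : ¬ P ≤ polar q π) (hline : OnGoodLine q π P) :
    ∃ a b : Fin N → F, a ∈ π ∧ a ∉ polar q π ∧ herm q a a = 0 ∧ b ∈ polar q π ∧ b ∉ π ∧
      herm q b b = 0 ∧ P = F ∙ (a + b) := by
  obtain ⟨A, B, hA1, hA2, hA3, hB1, hB2, hB3, hPAB, hTI⟩ := hline
  obtain ⟨a0, ha0, ha0'⟩ := SetLike.not_le_iff_exists.1 hA3
  obtain ⟨b0, hb0, hb0'⟩ := SetLike.not_le_iff_exists.1 hB3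
  have hap : a0 ∉ polar q π := fun h => ha0' ⟨hA2 ha0, h⟩
  have hbW : b0 ∉ π := fun h => hb0' ⟨h, hB2 hb0⟩
  have hAs := eq_span_of_finrank_one hA1 ha0 (fun h => hap (h ▸ Submodule.zero_mem _))
  have hBs := eq_span_of_finrank_one hB1 hb0 (fun h => hbW (h ▸ Submodule.zero_mem _))
  obtain ⟨x, hxP, hxπ⟩ := SetLike.not_le_iff_exists.1 hPπ
  have hx0 : x ≠ 0 := fun h => hxπ (h ▸ Submodule.zero_mem _)
  have hPs := eq_span_of_finrank_one hP.1 hxP hx0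
  obtain ⟨y, hy, z, hz, rfl⟩ := Submodule.mem_sup.1 (hPAB hxP)
  have hy2 := hy
  have hz2 := hz
  rw [hAs] at hy
  rw [hBs] at hz
  obtain ⟨c, rfl⟩ := Submodule.mem_span_singleton.1 hy
  obtain ⟨d, rfl⟩ := Submodule.mem_span_singleton.1 hz
  have hc : c ≠ 0 := by
    rintro rfl
    apply hPσ
    rw [hPs, Submodule.span_singleton_le_iff_mem, zero_smul, zero_add]
    exact hB2 hz2
  have hd : d ≠ 0 := by
    rintro rfl
    apply hxπ
    rw [zero_smul, add_zero]
    exact hA2 hy2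
  exact ⟨c • a0, d • b0, hA2 hy2, fun h => hap ((Submodule.smul_mem_iff _ hc).1 h),
    hTI _ (Submodule.mem_sup_left hy2), hB2 hz2,
    fun h => hbW ((Submodule.smul_mem_iff _ hd).1 h), hTI _ (Submodule.mem_sup_right hz2), hPs⟩

end assembly

/-- Number of generators through a point `P ∈ ⟨π, π^σ⟩` lying on a line of `H`
meeting `π \\ πᵢ` and `π^σ \\ πᵢ`, meeting each of `π \\ πᵢ` and `π^σ \\ πᵢ`
in exactly one point, for `i ≤ n-4`. -/
theorem stmt11 (n q p hh : ℕ) (hn : 2 ≤ n) (hp : p.Prime) (hh1 : 1 ≤ hh)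
    (hq : q = p ^ hh)
    (F : Type) [Field F] [Fintype F] (hF : Fintype.card F = q ^ 2)
    (i : ℤ) (hi1 : -1 ≤ i) (hi2 : i ≤ (n:ℤ) - 4)
    (π : Submodule F (Fin (2*n+2) → F)) (hπ : Module.finrank F π = n + 1)
    (hdim : (Module.finrank F ↥(π ⊓ polar q π) : ℤ) = i + 1)
    (P : Submodule F (Fin (2*n+2) → F)) (hP : IsHermPoint q P)
    (hPπ : ¬ P ≤ π) (hPσ : ¬ P ≤ polar q π)
    (hPspan : P ≤ π ⊔ polar q π)
    (hline : OnGoodLine q π P) :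
    (Nat.card {μ : Submodule F (Fin (2*n+2) → F) //
        IsGenerator q n μ ∧ P ≤ μ ∧
        (∃! R : Submodule F (Fin (2*n+2) → F),
          Module.finrank F R = 1 ∧ R ≤ μ ⊓ π ∧ ¬ R ≤ π ⊓ polar q π) ∧
        (∃! R : Submodule F (Fin (2*n+2) → F),
          Module.finrank F R = 1 ∧ R ≤ μ ⊓ polar q π ∧ ¬ R ≤ π ⊓ polar q π)} : ℚ)
      = NN q (n-1) (i+1) * (q:ℚ)^(4*i+4) * muH q ((n:ℤ)-i-3)
          * ((q:ℚ)^(4:ℤ) * muH q ((n:ℤ)-i-3) + (q:ℚ)^2 - 1) := by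
  have H : Good q F := Good.mk' hp hh1 hq hF
  obtain ⟨a, b, ha, hap, haa, hb, hbW, hbb, rfl⟩ := good_line H hP hPπ hPσ hline
  obtain ⟨r, rfl⟩ : ∃ r : ℕ, i = (r : ℤ) - 1 := ⟨(i + 1).toNat, by omega⟩
  obtain ⟨t, rfl⟩ : ∃ t : ℕ, n = t + r + 3 := ⟨n - r - 3, by omega⟩
  have hR : Module.finrank F ↥(π ⊓ polar q π) = r := by omega
  have hN : 2 * (t + r + 3) + 2 = 2 * (t + r + 3 + 1) := by ring
  have hiff : ∀ μ : Submodule F (Fin (2*(t + r + 3)+2) → F),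
      (IsGenerator q (t + r + 3) μ ∧ F ∙ (a + b) ≤ μ ∧
        (∃! R : Submodule F (Fin (2*(t + r + 3)+2) → F),
          Module.finrank F R = 1 ∧ R ≤ μ ⊓ π ∧ ¬ R ≤ π ⊓ polar q π) ∧
        (∃! R : Submodule F (Fin (2*(t + r + 3)+2) → F),
          Module.finrank F R = 1 ∧ R ≤ μ ⊓ polar q π ∧ ¬ R ≤ π ⊓ polar q π)) ↔
      GG q (t + r + 3 + 1) π (a + b) μ := by
    intro μ
    rw [exu_iff, exu_iff, Submodule.span_singleton_le_iff_mem]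
    have e1 : μ ⊓ π ⊓ (π ⊓ polar q π) = μ ⊓ (π ⊓ polar q π) := by
      rw [inf_assoc, ← inf_assoc π, inf_idem]
    have e2 : μ ⊓ polar q π ⊓ (π ⊓ polar q π) = μ ⊓ (π ⊓ polar q π) := by
      rw [inf_assoc, inf_comm π, ← inf_assoc (polar q π), inf_idem]
    rw [e1, e2]
    constructor
    · rintro ⟨⟨h1, h2⟩, h3, ⟨h4, h5⟩, -⟩
      exact ⟨h1, h2, h3, h4, h5⟩
    · rintro ⟨h1, h2, h3, h4, h5⟩
      exact ⟨⟨h1, h2⟩, h3, ⟨h4, h5⟩, by rw [finrank_inf_polar H hN h1 h2 hπ, h4], h5⟩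
  rw [Nat.card_congr (Equiv.subtypeEquivRight hiff)]
  have h1 := case_one (r := r) (k := t + 2) H hN hπ (by omega) hR ha hap haa hb hbW hbb
  have h2 := case_two (r := r) (k := t) H hN hπ (by omega) hR ha hap haa hb hbW hbb
  have h3 := card_diff_aux (fun μ => GG q (t + r + 3 + 1) π (a + b) μ)
    (fun μ => GG q (t + r + 3 + 1) π (a + b) μ ∧ μ ⊓ π ≤ π ⊓ polar q π ⊔ F ∙ a)
    (fun μ h => h.1)
  have h4 : Nat.card {μ // GG q (t + r + 3 + 1) π (a + b) μ ∧
      ¬ (GG q (t + r + 3 + 1) π (a + b) μ ∧ μ ⊓ π ≤ π ⊓ polar q π ⊔ F ∙ a)} =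
      Nat.card {μ // GG q (t + r + 3 + 1) π (a + b) μ ∧
        ¬ μ ⊓ π ≤ π ⊓ polar q π ⊔ F ∙ a} :=
    Nat.card_congr (Equiv.subtypeEquivRight fun μ => by tauto)
  rw [h4, h1] at h3
  have h5 := final_algebra H.two_le t r _ h2
  have e1 : t + r + 3 - 1 = t + r + 2 := by omega
  have e2 : (r : ℤ) - 1 + 1 = r := by ring
  have e3 : 4 * ((r : ℤ) - 1) + 4 = ((4 * r : ℕ) : ℤ) := by push_cast; ring
  have e4 : ((t + r + 3 : ℕ) : ℤ) - ((r : ℤ) - 1) - 3 = (t : ℤ) + 1 := by push_cast; ring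
  have e5 : (q : ℚ) ^ (4 : ℤ) = (q : ℚ) ^ 4 := by norm_cast
  rw [e1, e2, e3, e4, e5, zpow_natCast, ← h5]
  linarith

end HermCode
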